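/- arXiv:2312.13167 — 6 statements merged into one kernel-verified Lean document; each statement's English description precedes it below -/
import Mathlib

section
/- Let Ω be a set and 𝒢 a set of real-valued functions on Ω that contains all constant functions and separates the points of Ω. Equip Ω with the coarsest topology τ(𝒢) making every element of 𝒢 continuous, and assume Ω is separable in τ(𝒢). Suppose there is a function p : Ω → ℝ, bounded below by a positive constant, which is proper with respect to τ(𝒢) (preimages of compact subsets of ℝ are compact in Ω) and which is the pointwise supremum of a nonempty family of finite nonnegative linear combinations of elements of 𝒢, and suppose every g ∈ 𝒢 satisfies |g(ω)| ≤ C_g·p(ω) for all ω ∈ Ω for some constant C_g > 0. Let μ and ν be Radon probability measures on the Borel σ-algebra of τ(𝒢) (inner regular with respect to compact sets) with ∫ p dμ < ∞ and ∫ p dν < ∞, and assume that ∫ f dμ ≤ ∫ f dν for every f in the lattice cone 𝓕 generated by 𝒢. Then there exists a Radon probability measure π on Ω × Ω whose first marginal is μ and second marginal is ν, such that for every g ∈ 𝒢 and every bounded nonnegative Borel measurable h : Ω → ℝ one has ∫_Ω h(ω₁) g(ω₁) dμ(ω₁) ≤ ∫_{Ω×Ω} h(ω₁) g(ω₂) dπ(ω₁,ω₂).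 -/
open MeasureTheory

/-- Finite nonnegative linear combinations of elements of `G`. -/
def nonnegCombos {Ω : Type*} (G : Set (Ω → ℝ)) : Set (Ω → ℝ) :=
  {f | ∃ (m : ℕ) (c : Fin m → ℝ) (g : Fin m → (Ω → ℝ)),
    (∀ i, 0 ≤ c i) ∧ (∀ i, g i ∈ G) ∧ f = fun ω => ∑ i, c i * g i ω}

/-- The lattice cone generated by `G`: finite pointwise maxima of finite nonnegative linear
combinations of elements of `G`. -/
def latticeCone {Ω : Type*} (G : Set (Ω → ℝ)) : Set (Ω → ℝ) :=
  {f | ∃ (m : ℕ) (u : Fin (m + 1) → (Ω → ℝ)),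
    (∀ i, u i ∈ nonnegCombos G) ∧
    f = fun ω => Finset.univ.sup' Finset.univ_nonempty (fun i => u i ω)}

open Set Filter Topology TopologicalSpace BoundedContinuousFunction CompactlySupported

lemma BoundedContinuousFunction.exists_stoneCech_extension {X : Type*} [TopologicalSpace X]
    (f : X →ᵇ ℝ) : ∃ F : C(StoneCech X, ℝ), ∀ x, F (stoneCechUnit x) = f x := by
  have hf : ∀ x, f x ∈ Icc (-‖f‖) ‖f‖ := fun x => abs_le.1 (f.norm_coe_le_norm x)
  have hc : Continuous fun x => (⟨f x, hf x⟩ : Icc (-‖f‖) ‖f‖) := f.continuous.subtype_mk hf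
  exact ⟨⟨Subtype.val ∘ stoneCechExtend hc,
    continuous_subtype_val.comp (continuous_stoneCechExtend hc)⟩, fun x => by simp⟩

/-- **Riesz representation** of a tight positive functional on the bounded continuous functions
on a Tychonoff space, with respect to any σ-algebra coarser than the Borel σ-algebra. -/
theorem exists_innerRegular_integral_eq_of_tight {X : Type*} [TopologicalSpace X] [T35Space X]
    [MeasurableSpace X] (hborel : ‹MeasurableSpace X› ≤ borel X)
    (Λ : (X →ᵇ ℝ) →ₗ[ℝ] ℝ) (hpos : ∀ f : X →ᵇ ℝ, (∀ x, 0 ≤ f x) → 0 ≤ Λ f)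
    (htight : ∀ ε : ℝ, 0 < ε → ∃ K : Set X, IsCompact K ∧
      ∀ f : X →ᵇ ℝ, (∀ x ∈ K, f x = 0) → (∀ x, f x ∈ Icc (0 : ℝ) 1) → Λ f ≤ ε) :
    ∃ π : Measure X, IsFiniteMeasure π ∧ π.InnerRegular ∧
      ∀ f : X →ᵇ ℝ, Measurable f → ∫ x, f x ∂π = Λ f := by
  let j : X → StoneCech X := stoneCechUnit
  have hj : IsEmbedding j := isEmbedding_stoneCechUnit
  let _ : MeasurableSpace (StoneCech X) := borel _
  have : BorelSpace (StoneCech X) := ⟨rfl⟩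
  let pull : C_c(StoneCech X, ℝ) → (X →ᵇ ℝ) := fun F =>
    (BoundedContinuousFunction.mkOfCompact F.toContinuousMap).compContinuous ⟨j, hj.continuous⟩
  let Λ' : C_c(StoneCech X, ℝ) →ₚ[ℝ] ℝ := PositiveLinearMap.mk₀
    { toFun := fun F => Λ (pull F)
      map_add' := fun F F' => by rw [← map_add]; rfl
      map_smul' := fun c F => by rw [RingHom.id_apply, ← map_smul]; rfl }
    (fun F hF => hpos _ fun x => hF _)
  let ρ : Measure (StoneCech X) := RealRMK.rieszMeasure Λ'
  have hρ : ∀ (F : C(StoneCech X, ℝ)) (f : X →ᵇ ℝ), (∀ x, F (j x) = f x) →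
      ∫ w, F w ∂ρ = Λ f := by
    intro F f hFf
    have h := RealRMK.integral_rieszMeasure Λ' (CompactlySupportedContinuousMap.continuousMapEquiv F)
    refine h.trans ?_
    change Λ (pull _) = Λ f
    congr 1
    ext x
    exact hFf x
  choose K hK hKΛ using fun n : ℕ => htight (1 / (n + 1)) Nat.one_div_pos_of_nat
  have hjK : ∀ n, IsCompact (j '' K n) := fun n => (hK n).image hj.continuous
  let T : Set (StoneCech X) := ⋃ n, j '' K n
  have hT : MeasurableSet T := MeasurableSet.iUnion fun n => (hjK n).measurableSet
  have hKρ : ∀ n : ℕ, ρ (j '' K n)ᶜ ≤ ENNReal.ofReal (1 / (n + 1)) := by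
    intro n
    refine le_of_forall_lt fun r hr => ?_
    obtain ⟨C, hC, hCc, hrC⟩ := (hjK n).isClosed.isOpen_compl.exists_lt_isCompact hr
    obtain ⟨F, hF0, hF1, hF⟩ := exists_continuous_zero_one_of_isClosed (hjK n).isClosed
      hCc.isClosed (disjoint_left.2 fun x hx hx' => hC hx' hx)
    refine hrC.trans_le ?_
    let f : X →ᵇ ℝ := (BoundedContinuousFunction.mkOfCompact F).compContinuous ⟨j, hj.continuous⟩
    have h1 : ∫ w, F w ∂ρ ≤ 1 / (n + 1) := by
      rw [hρ F f fun x => rfl]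
      exact hKΛ n f (fun x hx => hF0 (mem_image_of_mem j hx)) fun x => hF _
    have hint : Integrable F ρ := (BoundedContinuousFunction.mkOfCompact F).integrable ρ
    have h2 : ρ.real C ≤ ∫ w, F w ∂ρ := by
      rw [← integral_indicator_one hCc.measurableSet]
      refine integral_mono ((integrable_const _).indicator hCc.measurableSet) hint fun w => ?_
      by_cases hw : w ∈ C
      · simp [hw, hF1 hw]
      · simpa [hw] using (hF w).1
    rw [← ofReal_measureReal]
    exact ENNReal.ofReal_le_ofReal (h2.trans h1)
  have hTc : ρ Tᶜ = 0 := by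
    have h0 : Tendsto (fun n : ℕ => ENNReal.ofReal (1 / ((n : ℝ) + 1))) atTop (𝓝 0) := by
      simpa using ENNReal.tendsto_ofReal tendsto_one_div_add_atTop_nhds_zero_nat
    exact le_antisymm (ge_of_tendsto' h0 fun n =>
      (measure_mono (compl_subset_compl.2 (subset_iUnion _ n))).trans (hKρ n)) bot_le
  have hTr : ∀ t : T, ∃ x, j x = t := by
    rintro ⟨t, ht⟩
    obtain ⟨n, x, -, hx⟩ := mem_iUnion.1 ht
    exact ⟨x, hx⟩
  choose inv hinv using hTr
  have hinvc : Continuous inv := by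
    rw [hj.continuous_iff, show j ∘ inv = Subtype.val from funext hinv]
    exact continuous_subtype_val
  have hinvm : Measurable inv := fun s hs => by
    rw [BorelSpace.measurable_eq (α := T)]
    exact hinvc.borel_measurable (hborel s hs)
  let κ : Measure T := ρ.comap Subtype.val
  have hκ : ∀ s, κ s = ρ (Subtype.val '' s) := comap_subtype_coe_apply hT ρ
  have : IsFiniteMeasure κ := ⟨by rw [hκ]; exact measure_lt_top _ _⟩
  refine ⟨κ.map inv, inferInstance, ⟨fun A hA r hr => ?_⟩, fun f hf => ?_⟩
  · rw [Measure.map_apply hinvm hA, hκ] at hr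
    obtain ⟨C, hCA, hC, hrC⟩ :=
      (hT.subtype_image (hinvm hA)).exists_lt_isCompact_of_ne_top (measure_ne_top ρ _) hr
    have hCT : Subtype.val '' (Subtype.val ⁻¹' C : Set T) = C := by
      rw [Subtype.image_preimage_coe, inter_eq_right]
      exact hCA.trans (Subtype.coe_image_subset _ _)
    have hC' : IsCompact (Subtype.val ⁻¹' C : Set T) := by
      rw [Subtype.isCompact_iff, hCT]
      exact hC
    refine ⟨inv '' (Subtype.val ⁻¹' C), ?_, hC'.image hinvc, ?_⟩
    · rintro _ ⟨t, ht, rfl⟩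
      obtain ⟨t', ht', h⟩ := hCA ht
      rwa [← Subtype.ext h]
    · calc r < κ (Subtype.val ⁻¹' C) := by rwa [hκ, hCT]
        _ ≤ κ (inv ⁻¹' (inv '' (Subtype.val ⁻¹' C))) := measure_mono (subset_preimage_image _ _)
        _ ≤ _ := Measure.le_map_apply hinvm.aemeasurable _
  · obtain ⟨F, hF⟩ := f.exists_stoneCech_extension
    rw [integral_map hinvm.aemeasurable hf.aestronglyMeasurable, ← hρ F f hF]
    have : ∀ t : T, f (inv t) = F t := fun t => by rw [← hF, ← hinv t]
    simp_rw [this]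
    rw [integral_subtype_comap hT, Measure.restrict_eq_self_of_ae_mem]
    exact hTc

section nonnegCombos

variable {Ω : Type*} {G : Set (Ω → ℝ)}

lemma add_mem_nonnegCombos {u v : Ω → ℝ} (hu : u ∈ nonnegCombos G) (hv : v ∈ nonnegCombos G) :
    u + v ∈ nonnegCombos G := by
  obtain ⟨m, c, g, hc, hg, rfl⟩ := hu
  obtain ⟨n, d, k, hd, hk, rfl⟩ := hv
  refine ⟨m + n, Fin.append c d, Fin.append g k, fun i => ?_, fun i => ?_, ?_⟩
  · refine Fin.addCases (fun i => ?_) (fun i => ?_) i <;> simp [hc, hd]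
  · refine Fin.addCases (fun i => ?_) (fun i => ?_) i <;> simp [hg, hk]
  · ext ω
    simp [Fin.sum_univ_add]

lemma smul_mem_nonnegCombos {r : ℝ} (hr : 0 ≤ r) {u : Ω → ℝ} (hu : u ∈ nonnegCombos G) :
    r • u ∈ nonnegCombos G := by
  obtain ⟨m, c, g, hc, hg, rfl⟩ := hu
  refine ⟨m, fun i => r * c i, g, fun i => mul_nonneg hr (hc i), hg, ?_⟩
  ext ω
  simp [Finset.mul_sum, mul_assoc]

lemma subset_nonnegCombos : G ⊆ nonnegCombos G := fun g hg =>
  ⟨1, fun _ => 1, fun _ => g, fun _ => zero_le_one, fun _ => hg, by simp⟩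

lemma integrable_of_mem_nonnegCombos [MeasurableSpace Ω] {μ : Measure Ω}
    (hG : ∀ g ∈ G, Integrable g μ) {u : Ω → ℝ} (hu : u ∈ nonnegCombos G) : Integrable u μ := by
  obtain ⟨m, c, g, hc, hg, rfl⟩ := hu
  exact integrable_finsetSum _ fun i _ => (hG _ (hg i)).const_mul _

end nonnegCombos

lemma integrable_finset_sup' {Ω ι : Type*} [MeasurableSpace Ω] {μ : Measure Ω} {s : Finset ι}
    (hs : s.Nonempty) {u : ι → Ω → ℝ} (hu : ∀ i ∈ s, Integrable (u i) μ) :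
    Integrable (fun ω => s.sup' hs fun i => u i ω) μ := by
  have : Integrable (s.sup' hs u) μ :=
    Finset.sup'_induction hs u (p := fun f => Integrable f μ) (fun _ hf _ hg => hf.sup hg) hu
  convert this using 1
  ext ω
  rw [Finset.sup'_apply]

/-- A family `q x` of nonnegative combinations of elements of `G`, depending continuously on the
base point `x` and vanishing there. -/
structure IsTangentFamily {Ω : Type*} [TopologicalSpace Ω] (G : Set (Ω → ℝ)) (q : Ω → Ω → ℝ) :
    Prop where
  mem (x : Ω) : q x ∈ nonnegCombos G
  continuous (y : Ω) : Continuous fun x => q x y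
  self (x : Ω) : q x x = 0

namespace IsTangentFamily

variable {Ω : Type*} [TopologicalSpace Ω] {G : Set (Ω → ℝ)} {q q' : Ω → Ω → ℝ}

lemma zero (hconst : ∀ c : ℝ, (fun _ : Ω => c) ∈ G) : IsTangentFamily G fun _ _ => 0 :=
  ⟨fun _ => subset_nonnegCombos (hconst 0), fun _ => continuous_const, fun _ => rfl⟩

lemma add (hq : IsTangentFamily G q) (hq' : IsTangentFamily G q') :
    IsTangentFamily G fun x y => q x y + q' x y :=
  ⟨fun x => add_mem_nonnegCombos (hq.mem x) (hq'.mem x),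
    fun y => (hq.continuous y).add (hq'.continuous y), fun x => by simp [hq.self, hq'.self]⟩

lemma const_mul (hq : IsTangentFamily G q) {r : ℝ} (hr : 0 ≤ r) :
    IsTangentFamily G fun x y => r * q x y :=
  ⟨fun x => smul_mem_nonnegCombos hr (hq.mem x), fun y => (hq.continuous y).const_mul r,
    fun x => by simp [hq.self]⟩

lemma mul_sub (hconst : ∀ c : ℝ, (fun _ : Ω => c) ∈ G) {g h : Ω → ℝ} (hg : g ∈ G)
    (hgc : Continuous g) (hh : Continuous h) (h0 : ∀ x, 0 ≤ h x) :
    IsTangentFamily G fun x y => h x * (g y - g x) := by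
  refine ⟨fun x => ?_, fun y => hh.mul (continuous_const.sub hgc), fun x => by simp⟩
  have := add_mem_nonnegCombos (smul_mem_nonnegCombos (h0 x) (subset_nonnegCombos hg))
    (subset_nonnegCombos (hconst (-(h x * g x))))
  convert this using 1
  ext y
  simp
  ring

/-- If a tangent family is dominated by `a ⊕ b`, the dual value of `(a, b)` is nonnegative. -/
theorem integral_add_integral_nonneg [MeasurableSpace Ω] [OpensMeasurableSpace Ω]
    [SeparableSpace Ω] [Nonempty Ω] (hq : IsTangentFamily G q)
    (hconst : ∀ c : ℝ, (fun _ : Ω => c) ∈ G) {μ ν : Measure Ω}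
    (hGμ : ∀ g ∈ G, Integrable g μ) (hGν : ∀ g ∈ G, Integrable g ν)
    (horder : ∀ f ∈ latticeCone G, ∫ ω, f ω ∂μ ≤ ∫ ω, f ω ∂ν)
    {a b : Ω → ℝ} (ha : Continuous a) (haμ : Integrable a μ) (hbν : Integrable b ν)
    (hab : ∀ x y, q x y ≤ a x + b y) :
    0 ≤ ∫ ω, a ω ∂μ + ∫ ω, b ω ∂ν := by
  let d := denseSeq Ω
  let u : ℕ → Ω → ℝ := fun k y => q (d k) y - a (d k)
  have hu : ∀ k, u k ∈ nonnegCombos G := fun k =>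
    add_mem_nonnegCombos (hq.mem (d k)) (subset_nonnegCombos (hconst (-a (d k))))
  let f : ℕ → Ω → ℝ := fun n y =>
    Finset.univ.sup' Finset.univ_nonempty fun i : Fin (n + 1) => u i y
  have hf : ∀ n, f n ∈ latticeCone G := fun n => ⟨n, fun i => u i, fun i => hu i, rfl⟩
  have hfμ : ∀ n, Integrable (f n) μ := fun n =>
    integrable_finset_sup' _ fun i _ => integrable_of_mem_nonnegCombos hGμ (hu i)
  have hfν : ∀ n, Integrable (f n) ν := fun n =>
    integrable_finset_sup' _ fun i _ => integrable_of_mem_nonnegCombos hGν (hu i)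
  have hle : ∀ n k, k ≤ n → ∀ y, u k y ≤ f n y := fun n k hk y =>
    Finset.le_sup' (fun i : Fin (n + 1) => u i y) (Finset.mem_univ (⟨k, by omega⟩ : Fin (n + 1)))
  have hfb : ∀ n y, f n y ≤ b y := fun n y =>
    Finset.sup'_le _ _ fun i _ => by have := hab (d i) y; simp only [u]; linarith
  have hbound : ∀ n, ∫ ω, min (f n ω) (-a ω) ∂μ ≤ ∫ ω, b ω ∂ν := fun n =>
    calc ∫ ω, min (f n ω) (-a ω) ∂μ ≤ ∫ ω, f n ω ∂μ :=
          integral_mono ((hfμ n).inf haμ.neg) (hfμ n) fun ω => min_le_left _ _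
      _ ≤ ∫ ω, f n ω ∂ν := horder _ (hf n)
      _ ≤ ∫ ω, b ω ∂ν := integral_mono (hfν n) hbν (hfb n)
  have hlim : ∀ y, Tendsto (fun n => min (f n y) (-a y)) atTop (𝓝 (-a y)) := by
    intro y
    refine tendsto_order.2 ⟨fun r hr => ?_, fun r hr => Eventually.of_forall fun n =>
      (min_le_right _ _).trans_lt hr⟩
    have hopen : IsOpen {x | r < q x y - a x} :=
      isOpen_lt continuous_const ((hq.continuous y).sub ha)
    obtain ⟨k, hk⟩ := (denseRange_denseSeq Ω).exists_mem_open hopen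
      ⟨y, by simpa [hq.self] using hr⟩
    filter_upwards [eventually_ge_atTop k] with n hn
    exact lt_min (lt_of_lt_of_le hk (hle n k hn y)) hr
  have htend : Tendsto (fun n => ∫ ω, min (f n ω) (-a ω) ∂μ) atTop (𝓝 (∫ ω, -a ω ∂μ)) := by
    refine tendsto_integral_of_dominated_convergence (fun ω => |f 0 ω| + |a ω|)
      (fun n => ((hfμ n).inf haμ.neg).aestronglyMeasurable) ((hfμ 0).abs.add haμ.abs)
      (fun n => Eventually.of_forall fun ω => ?_) (Eventually.of_forall hlim)
    have h1 : f 0 ω ≤ f n ω := Finset.sup'_le _ _ fun i _ =>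
      hle n i (by omega) ω
    rw [Real.norm_eq_abs, abs_le]
    constructor
    · refine le_min ?_ ?_ <;>
        linarith [neg_abs_le (f 0 ω), le_abs_self (a ω), abs_nonneg (a ω), abs_nonneg (f 0 ω)]
    · exact (min_le_right _ _).trans (by linarith [neg_abs_le (a ω), abs_nonneg (f 0 ω)])
  have := le_of_tendsto' htend hbound
  rw [integral_neg] at this
  linarith

end IsTangentFamily

/-- The continuous `μ`-integrable real functions. -/
def continuousIntegrable {Ω : Type*} [TopologicalSpace Ω] [MeasurableSpace Ω] (μ : Measure Ω) :
    Submodule ℝ (Ω → ℝ) where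
  carrier := {f | Continuous f ∧ Integrable f μ}
  add_mem' hf hg := ⟨hf.1.add hg.1, hf.2.add hg.2⟩
  zero_mem' := ⟨continuous_const, integrable_zero _ _ _⟩
  smul_mem' r _ hf := ⟨hf.1.const_smul r, hf.2.smul r⟩

/-- Integration as a linear functional on the continuous integrable functions. -/
noncomputable def integralContinuousIntegrable {Ω : Type*} [TopologicalSpace Ω]
    [MeasurableSpace Ω] (μ : Measure Ω) : continuousIntegrable μ →ₗ[ℝ] ℝ where
  toFun f := ∫ ω, f.1 ω ∂μ
  map_add' f g := integral_add f.2.2 g.2.2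
  map_smul' r f := integral_const_mul r f.1

/-- There is a linear functional on bounded continuous functions of two variables which has
marginals `μ` and `ν` and is nonnegative on all tangent families, both expressed at once through
an inequality allowing unbounded functions of one variable. -/
theorem exists_linearMap_nonneg_of_isTangentFamily {Ω : Type*} [TopologicalSpace Ω]
    [MeasurableSpace Ω] [OpensMeasurableSpace Ω] [SeparableSpace Ω] [Nonempty Ω]
    {G : Set (Ω → ℝ)} (hconst : ∀ c : ℝ, (fun _ : Ω => c) ∈ G) {μ ν : Measure Ω}
    [IsFiniteMeasure μ] (hGμ : ∀ g ∈ G, Integrable g μ) (hGν : ∀ g ∈ G, Integrable g ν)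
    (horder : ∀ f ∈ latticeCone G, ∫ ω, f ω ∂μ ≤ ∫ ω, f ω ∂ν) :
    ∃ Λ : (Ω × Ω →ᵇ ℝ) →ₗ[ℝ] ℝ, ∀ (q : Ω → Ω → ℝ) (a b : Ω → ℝ) (φ : Ω × Ω →ᵇ ℝ),
      IsTangentFamily G q → Continuous a → Integrable a μ → Continuous b → Integrable b ν →
      (∀ x y, q x y ≤ a x + b y + φ (x, y)) → 0 ≤ ∫ ω, a ω ∂μ + ∫ ω, b ω ∂ν + Λ φ := by
  let E := continuousIntegrable μ × continuousIntegrable ν × (Ω × Ω →ᵇ ℝ)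
  let s : PointedCone ℝ E :=
    { carrier := {e | ∃ q, IsTangentFamily G q ∧
        ∀ x y, q x y ≤ e.1.1 x + e.2.1.1 y + e.2.2 (x, y)}
      add_mem' := by
        rintro e e' ⟨q, hq, h⟩ ⟨q', hq', h'⟩
        refine ⟨_, hq.add hq', fun x y => (add_le_add (h x y) (h' x y)).trans_eq ?_⟩
        change _ = (e.1.1 x + e'.1.1 x) + (e.2.1.1 y + e'.2.1.1 y) +
          (e.2.2 (x, y) + e'.2.2 (x, y))
        ring
      zero_mem' := ⟨_, .zero hconst, fun x y => by simp⟩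
      smul_mem' := by
        rintro ⟨r, hr⟩ e ⟨q, hq, h⟩
        refine ⟨_, hq.const_mul hr, fun x y => (mul_le_mul_of_nonneg_left (h x y) hr).trans_eq ?_⟩
        change _ = r * e.1.1 x + r * e.2.1.1 y + r * e.2.2 (x, y)
        ring }
  let f₀ : E →ₗ[ℝ] ℝ :=
    (integralContinuousIntegrable μ).comp (LinearMap.fst ℝ _ _) +
      (integralContinuousIntegrable ν).comp ((LinearMap.fst ℝ _ _).comp (LinearMap.snd ℝ _ _))
  let D : Submodule ℝ E := LinearMap.ker ((LinearMap.snd ℝ _ _).comp (LinearMap.snd ℝ _ _))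
  have hD : ∀ e : E, e ∈ D ↔ e.2.2 = 0 := fun e => LinearMap.mem_ker
  obtain ⟨L, hLf, hLs⟩ := riesz_extension s ⟨D, f₀.comp D.subtype⟩
    (by
      rintro ⟨e, he⟩ ⟨q, hq, h⟩
      rw [hD] at he
      refine hq.integral_add_integral_nonneg hconst hGμ hGν horder e.1.2.1 e.1.2.2 e.2.1.2.2
        fun x y => ?_
      have := h x y
      simp only at this
      rwa [he, BoundedContinuousFunction.coe_zero, Pi.zero_apply, add_zero] at this)
    (by
      intro e
      let c : continuousIntegrable μ := ⟨fun _ => ‖e.2.2‖, continuous_const, integrable_const _⟩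
      refine ⟨⟨(c - e.1, -e.2.1, 0), (hD _).2 rfl⟩, _, .zero hconst, fun x y => ?_⟩
      have h := neg_abs_le (e.2.2 (x, y))
      have h' := e.2.2.norm_coe_le_norm (x, y)
      rw [Real.norm_eq_abs] at h'
      change 0 ≤ (‖e.2.2‖ - e.1.1 x + e.1.1 x) + (-e.2.1.1 y + e.2.1.1 y) +
        (0 + e.2.2 (x, y))
      linarith)
  refine ⟨L.comp ((LinearMap.inr ℝ _ _).comp (LinearMap.inr ℝ _ _)),
    fun q a b φ hq ha haμ hb hbν h => ?_⟩
  let A : continuousIntegrable μ := ⟨a, ha, haμ⟩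
  let B : continuousIntegrable ν := ⟨b, hb, hbν⟩
  have h1 := hLs (A, B, φ) ⟨q, hq, h⟩
  have h2 : L (A, B, 0) = ∫ ω, a ω ∂μ + ∫ ω, b ω ∂ν := hLf ⟨(A, B, 0), (hD _).2 rfl⟩
  have h3 : ((A, B, φ) : E) = (A, B, 0) + (0, 0, φ) := by simp
  rw [h3, map_add, h2] at h1
  exact h1

theorem completelyRegularSpace_of_eq_iInf_induced {Ω : Type*} [tΩ : TopologicalSpace Ω]
    {G : Set (Ω → ℝ)} (htop : tΩ = ⨅ g ∈ G, TopologicalSpace.induced g inferInstance) :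
    CompletelyRegularSpace Ω := by
  rw [iInf_subtype'] at htop
  rw [htop]
  exact completelyRegularSpace_iInf fun g => completelyRegularSpace_induced inferInstance _

theorem sigmaCompactSpace_of_isCompact_preimage {Ω : Type*} [TopologicalSpace Ω] {p : Ω → ℝ}
    (hproper : ∀ K : Set ℝ, IsCompact K → IsCompact (p ⁻¹' K)) : SigmaCompactSpace Ω := by
  refine ⟨fun n : ℕ => p ⁻¹' Icc (-n) n, fun n => hproper _ isCompact_Icc,
    eq_univ_of_forall fun ω => ?_⟩
  obtain ⟨n, hn⟩ := exists_nat_ge |p ω|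
  exact mem_iUnion.2 ⟨n, abs_le.1 hn⟩

lemma integral_le_measureReal_compl {Ω : Type*} [TopologicalSpace Ω] [MeasurableSpace Ω]
    [OpensMeasurableSpace Ω] {μ : Measure Ω} [IsFiniteMeasure μ] {a : Ω →ᵇ ℝ}
    {K : Set Ω} (hK : MeasurableSet K) (h0 : EqOn a 0 K) (h1 : ∀ ω, a ω ≤ 1) :
    ∫ ω, a ω ∂μ ≤ μ.real Kᶜ := by
  rw [← integral_indicator_one hK.compl]
  refine integral_mono (a.integrable μ) ((integrable_const _).indicator hK.compl) fun ω => ?_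
  by_cases hω : ω ∈ K
  · simp [hω, h0 hω]
  · simpa [hω] using h1 ω

/-- Urysohn functions, bundled as bounded continuous functions. -/
lemma exists_boundedContinuous_zero_one {Ω : Type*} [TopologicalSpace Ω] [NormalSpace Ω]
    {s t : Set Ω}
    (hs : IsClosed s) (ht : IsClosed t) (hd : Disjoint s t) :
    ∃ a : Ω →ᵇ ℝ, EqOn a 0 s ∧ EqOn a 1 t ∧ ∀ ω, a ω ∈ Icc (0 : ℝ) 1 := by
  obtain ⟨a, h0, h1, ha⟩ := exists_continuous_zero_one_of_isClosed hs ht hd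
  exact ⟨.ofNormedAddCommGroup a a.continuous 1 fun ω => abs_le.2
    ⟨by linarith [(ha ω).1], (ha ω).2⟩, h0, h1, ha⟩

section Regular

variable {Ω : Type*} [TopologicalSpace Ω] [T4Space Ω] [MeasurableSpace Ω] [BorelSpace Ω]

lemma measure_isOpen_le_of_integral_eq {μ ρ : Measure Ω} [IsFiniteMeasure μ] [IsFiniteMeasure ρ]
    [μ.InnerRegular] (h : ∀ a : Ω →ᵇ ℝ, ∫ ω, a ω ∂μ = ∫ ω, a ω ∂ρ) {U : Set Ω} (hU : IsOpen U) :
    μ U ≤ ρ U := by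
  refine le_of_forall_lt fun r hr => ?_
  obtain ⟨K, hKU, hK, hrK⟩ := hU.measurableSet.exists_lt_isCompact hr
  obtain ⟨a, h0, h1, ha⟩ := exists_boundedContinuous_zero_one hU.isClosed_compl hK.isClosed
    (disjoint_left.2 fun ω hω hω' => hω (hKU hω'))
  refine hrK.trans_le ?_
  have hρ : ∫ ω, a ω ∂ρ ≤ ρ.real U := by
    simpa using integral_le_measureReal_compl (μ := ρ) hU.measurableSet.compl h0 fun ω => (ha ω).2
  have hμ : μ.real K ≤ ∫ ω, a ω ∂μ := by
    rw [← integral_indicator_one hK.measurableSet]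
    refine integral_mono ((integrable_const _).indicator hK.measurableSet) (a.integrable μ)
      fun ω => ?_
    by_cases hω : ω ∈ K
    · simp [hω, h1 hω]
    · simpa [hω] using (ha ω).1
  rw [← ofReal_measureReal, ← ofReal_measureReal]
  exact ENNReal.ofReal_le_ofReal (hμ.trans ((h a).trans_le hρ))

/-- Radon measures are determined by the integrals of bounded continuous functions. -/
theorem ext_of_forall_integral_eq_of_innerRegular {μ ρ : Measure Ω} [IsFiniteMeasure μ]
    [IsFiniteMeasure ρ] [μ.InnerRegular] [ρ.InnerRegular]
    (h : ∀ a : Ω →ᵇ ℝ, ∫ ω, a ω ∂μ = ∫ ω, a ω ∂ρ) : μ = ρ := by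
  have hopen : ∀ U, IsOpen U → μ U = ρ U := fun U hU =>
    le_antisymm (measure_isOpen_le_of_integral_eq h hU)
      (measure_isOpen_le_of_integral_eq (fun a => (h a).symm) hU)
  exact ext_of_generate_finite {U | IsOpen U} (BorelSpace.measurable_eq (α := Ω)) isPiSystem_isOpen
    hopen (hopen _ isOpen_univ)

/-- A functional on bounded continuous functions of two variables dominated by Radon marginals
is tight. -/
theorem exists_isCompact_forall_le_of_marginals {μ ν : Measure Ω} [IsProbabilityMeasure μ]
    [IsProbabilityMeasure ν] [μ.InnerRegular] [ν.InnerRegular] {Λ : (Ω × Ω →ᵇ ℝ) → ℝ}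
    (hΛ : ∀ (φ : Ω × Ω →ᵇ ℝ) (a b : Ω →ᵇ ℝ), (∀ x y, φ (x, y) ≤ a x + b y) →
      Λ φ ≤ ∫ ω, a ω ∂μ + ∫ ω, b ω ∂ν) {ε : ℝ} (hε : 0 < ε) :
    ∃ K : Set (Ω × Ω), IsCompact K ∧
      ∀ f : Ω × Ω →ᵇ ℝ, (∀ x ∈ K, f x = 0) → (∀ x, f x ∈ Icc (0 : ℝ) 1) → Λ f ≤ ε := by
  have key : ∀ (κ : Measure Ω) [IsProbabilityMeasure κ] [κ.InnerRegular],
      ∃ K, IsCompact K ∧ κ.real Kᶜ ≤ ε / 3 := by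
    intro κ _ _
    obtain ⟨K, -, hK, hKε⟩ := MeasurableSet.univ.exists_isCompact_sdiff_lt (measure_ne_top κ _)
      (ENNReal.ofReal_pos.2 (by positivity : 0 < ε / 3)).ne'
    rw [← compl_eq_univ_sdiff] at hKε
    exact ⟨K, hK, ENNReal.toReal_le_of_le_ofReal (by positivity) hKε.le⟩
  obtain ⟨K₁, hK₁, hμK⟩ := key μ
  obtain ⟨K₂, hK₂, hνK⟩ := key ν
  refine ⟨K₁ ×ˢ K₂, hK₁.prod hK₂, fun f hf0 hf => ?_⟩
  obtain ⟨u, v, hu, hv, hKu, hKv, huv⟩ := generalized_tube_lemma hK₁ hK₂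
    (isOpen_lt f.continuous (continuous_const (y := ε / 3)))
    (fun x hx => by rw [mem_ofPred_eq, hf0 x hx]; positivity)
  obtain ⟨a, ha0, ha1, ha⟩ := exists_boundedContinuous_zero_one hK₁.isClosed hu.isClosed_compl
    (disjoint_left.2 fun ω hω hω' => hω' (hKu hω))
  obtain ⟨b, hb0, hb1, hb⟩ := exists_boundedContinuous_zero_one hK₂.isClosed hv.isClosed_compl
    (disjoint_left.2 fun ω hω hω' => hω' (hKv hω))
  have h := hΛ f (a + const Ω (ε / 3)) b fun x y => by
    simp only [BoundedContinuousFunction.coe_add, Pi.add_apply, const_apply]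
    by_cases hx : x ∈ u
    · by_cases hy : y ∈ v
      · have : f (x, y) < ε / 3 := huv (mk_mem_prod hx hy)
        linarith [(ha x).1, (hb y).1]
      · have : b y = 1 := hb1 hy
        linarith [(ha x).1, (hf (x, y)).2]
    · have : a x = 1 := ha1 hx
      linarith [(hb y).1, (hf (x, y)).2]
  simp only [BoundedContinuousFunction.coe_add, Pi.add_apply, const_apply] at h
  rw [integral_add (a.integrable μ) (integrable_const _), integral_const, probReal_univ,
    one_smul] at h
  have h1 := integral_le_measureReal_compl (μ := μ) hK₁.measurableSet ha0 fun ω => (ha ω).2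
  have h2 := integral_le_measureReal_compl (μ := ν) hK₂.measurableSet hb0 fun ω => (hb ω).2
  linarith

end Regular

lemma innerRegular_map_of_continuous {X Y : Type*} [TopologicalSpace X] [MeasurableSpace X]
    [TopologicalSpace Y] [MeasurableSpace Y] {π : Measure X} [hπ : π.InnerRegular] {f : X → Y}
    (hf : Continuous f) (hfm : Measurable f) : (π.map f).InnerRegular := by
  refine ⟨fun A hA r hr => ?_⟩
  rw [Measure.map_apply hfm hA] at hr
  obtain ⟨C, hCA, hC, hrC⟩ := hπ.innerRegular (hfm hA) r hr
  exact ⟨f '' C, image_subset_iff.2 hCA, hC.image hf, hrC.trans_le <|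
    (measure_mono (subset_preimage_image _ _)).trans (Measure.le_map_apply hfm.aemeasurable _)⟩

/-- Bounded nonnegative measurable functions are almost everywhere limits of uniformly bounded
nonnegative continuous functions. -/
theorem exists_seq_continuous_tendsto_ae {Ω : Type*} [TopologicalSpace Ω] [NormalSpace Ω]
    [MeasurableSpace Ω] [BorelSpace Ω] {μ : Measure Ω} [IsFiniteMeasure μ] [μ.WeaklyRegular]
    {h : Ω → ℝ} (hm : Measurable h) {M : ℝ} (hM : 0 ≤ M)
    (hh : ∀ ω, h ω ∈ Icc 0 M) :
    ∃ k : ℕ → Ω → ℝ, (∀ n, Continuous (k n)) ∧ (∀ n ω, k n ω ∈ Icc 0 M) ∧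
      ∀ᵐ ω ∂μ, Tendsto (fun n => k n ω) atTop (𝓝 (h ω)) := by
  have hint : Integrable h μ := Integrable.of_bound hm.aestronglyMeasurable M <|
    Eventually.of_forall fun ω => abs_le.2 ⟨by linarith [(hh ω).1, (hh ω).2], (hh ω).2⟩
  choose f hf hfi using fun n : ℕ =>
    (memLp_one_iff_integrable.2 hint).exists_boundedContinuous_eLpNorm_sub_le
      ENNReal.one_ne_top (ε := (n : ENNReal)⁻¹) (by simp)
  have hmeas : TendstoInMeasure μ (fun n => ⇑(f n)) atTop h := by
    refine tendstoInMeasure_of_tendsto_eLpNorm one_ne_zero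
      (fun n => (hfi n).aestronglyMeasurable) hm.aestronglyMeasurable ?_
    refine tendsto_of_tendsto_of_tendsto_of_le_of_le tendsto_const_nhds
      ENNReal.tendsto_inv_nat_nhds_zero (fun n => bot_le) fun n => ?_
    rw [eLpNorm_sub_comm]
    exact hf n
  obtain ⟨ns, -, hns⟩ := hmeas.exists_seq_tendsto_ae
  refine ⟨fun n ω => max 0 (min (f (ns n) ω) M), fun n => by fun_prop,
    fun n ω => ⟨le_max_left _ _, max_le hM (min_le_right _ _)⟩, ?_⟩
  filter_upwards [hns] with ω hω
  have := tendsto_const_nhds (x := (0 : ℝ)) |>.max (hω.min (tendsto_const_nhds (x := M)))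
  rwa [min_eq_left (hh ω).2, max_eq_right (hh ω).1] at this

lemma tendsto_integral_abs_sub_truncate {Ω : Type*} [MeasurableSpace Ω] {ν : Measure Ω}
    {g : Ω → ℝ} (hgm : Measurable g) (hg : Integrable g ν) :
    Tendsto (fun n : ℕ => ∫ ω, |g ω - max (-(n : ℝ)) (min (g ω) n)| ∂ν) atTop (𝓝 0) := by
  rw [← integral_zero Ω ℝ (μ := ν)]
  refine tendsto_integral_of_dominated_convergence (fun ω => |g ω|)
    (fun n => (by fun_prop : Measurable _).aestronglyMeasurable) hg.abs
    (fun n => Eventually.of_forall fun ω => ?_) (Eventually.of_forall fun ω => ?_)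
  · have hn : (0 : ℝ) ≤ n := n.cast_nonneg
    rw [Real.norm_eq_abs, abs_abs]
    rcases le_total (g ω) n with h1 | h1
    · rw [min_eq_left h1]
      rcases le_total (-(n : ℝ)) (g ω) with h2 | h2
      · rw [max_eq_right h2, sub_self, abs_zero]
        exact abs_nonneg _
      · rw [max_eq_left h2, abs_of_nonpos (by linarith), abs_of_nonpos (by linarith)]
        linarith
    · rw [min_eq_right h1, max_eq_right (by linarith), abs_of_nonneg (by linarith),
        abs_of_nonneg (by linarith)]
      linarith
  · obtain ⟨N, hN⟩ := exists_nat_ge |g ω|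
    refine tendsto_const_nhds.congr' ?_
    filter_upwards [eventually_ge_atTop N] with n hn
    have h := abs_le.1 (hN.trans (Nat.cast_le.2 hn))
    rw [min_eq_left h.2, max_eq_right h.1, sub_self, abs_zero]

/-- The transport inequality for bounded continuous weights, from the inequality for the
representing functional. -/
theorem integral_mul_le_integral_of_continuous {Ω : Type*} [TopologicalSpace Ω] [MeasurableSpace Ω]
    [OpensMeasurableSpace Ω] {G : Set (Ω → ℝ)} (hconst : ∀ c : ℝ, (fun _ : Ω => c) ∈ G)
    {μ ν : Measure Ω} {π : Measure (Ω × Ω)} [IsFiniteMeasure π] {Λ : (Ω × Ω →ᵇ ℝ) → ℝ}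
    (hΛ : ∀ (q : Ω → Ω → ℝ) (a b : Ω → ℝ) (φ : Ω × Ω →ᵇ ℝ),
      IsTangentFamily G q → Continuous a → Integrable a μ → Continuous b → Integrable b ν →
      (∀ x y, q x y ≤ a x + b y + φ (x, y)) → 0 ≤ ∫ ω, a ω ∂μ + ∫ ω, b ω ∂ν + Λ φ)
    (hπ : ∀ φ : Ω × Ω →ᵇ ℝ, Measurable φ → ∫ x, φ x ∂π = Λ φ) (hsnd : π.map Prod.snd = ν)
    {g h : Ω → ℝ} (hgG : g ∈ G) (hgc : Continuous g) (hgμ : Integrable g μ) (hgν : Integrable g ν)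
    (hh : Continuous h) {M : ℝ} (hhM : ∀ ω, h ω ∈ Icc 0 M) :
    ∫ ω, h ω * g ω ∂μ ≤ ∫ x : Ω × Ω, h x.1 * g x.2 ∂π := by
  have hbdd : ∀ ω, ‖h ω‖ ≤ M := fun ω =>
    abs_le.2 ⟨by linarith [(hhM ω).1, (hhM ω).2], (hhM ω).2⟩
  have hhm := hh.measurable
  have hgm := hgc.measurable
  have hgπ : Integrable (fun x : Ω × Ω => g x.2) π := by
    rw [← hsnd] at hgν
    exact hgν.comp_measurable measurable_snd
  have hhg : Integrable (fun x : Ω × Ω => h x.1 * g x.2) π :=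
    hgπ.bdd_mul (by fun_prop : Measurable _).aestronglyMeasurable
      (Eventually.of_forall fun x => hbdd x.1)
  have hhgμ : Integrable (fun ω => h ω * g ω) μ :=
    hgμ.bdd_mul hhm.aestronglyMeasurable (Eventually.of_forall hbdd)
  have key : ∀ n : ℕ, ∫ ω, h ω * g ω ∂μ ≤ ∫ x : Ω × Ω, h x.1 * g x.2 ∂π +
      2 * M * ∫ ω, |g ω - max (-(n : ℝ)) (min (g ω) n)| ∂ν := by
    intro n
    let t : Ω → ℝ := fun ω => max (-(n : ℝ)) (min (g ω) n)
    have htc : Continuous t := by fun_prop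
    have htm : Measurable t := htc.measurable
    have htb : ∀ ω, ‖t ω‖ ≤ n := fun ω => abs_le.2
      ⟨le_max_left _ _, max_le (by linarith [n.cast_nonneg (α := ℝ)]) (min_le_right _ _)⟩
    let φ : Ω × Ω →ᵇ ℝ :=
      (ofNormedAddCommGroup h hh M hbdd).compContinuous ⟨Prod.fst, continuous_fst⟩ *
        (ofNormedAddCommGroup t htc n htb).compContinuous ⟨Prod.snd, continuous_snd⟩
    have hφ : ∀ x, φ x = h x.1 * t x.2 := fun x => rfl
    have hφm : Measurable φ := by
      change Measurable fun x : Ω × Ω => h x.1 * t x.2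
      fun_prop
    have hdiff : Integrable (fun ω => |g ω - t ω|) ν := by
      have : Integrable t (π.map Prod.snd) :=
        Integrable.of_bound htm.aestronglyMeasurable n (Eventually.of_forall htb)
      rw [hsnd] at this
      exact (hgν.sub this).abs
    have hdiffπ : Integrable (fun x : Ω × Ω => |g x.2 - t x.2|) π := by
      rw [← hsnd] at hdiff
      exact hdiff.comp_measurable measurable_snd
    have h1 := hΛ _ (fun ω => -(h ω * g ω)) (fun ω => M * |g ω - t ω|) φ
      (.mul_sub hconst hgG hgc hh fun ω => (hhM ω).1) (hh.mul hgc).neg hhgμ.neg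
      (by fun_prop) (hdiff.const_mul M) fun x y => by
        rw [hφ]
        have e1 := mul_le_mul_of_nonneg_left (le_abs_self (g y - t y)) (hhM x).1
        have e2 := mul_le_mul_of_nonneg_right (hhM x).2 (abs_nonneg (g y - t y))
        linarith
    rw [integral_neg, integral_const_mul, ← hπ φ hφm] at h1
    have h2 : ∫ x, φ x ∂π ≤ ∫ x : Ω × Ω, (h x.1 * g x.2 + M * |g x.2 - t x.2|) ∂π := by
      refine integral_mono (Integrable.of_bound hφm.aestronglyMeasurable ‖φ‖
        (Eventually.of_forall φ.norm_coe_le_norm)) (hhg.add (hdiffπ.const_mul M))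
        fun x => ?_
      have e1 := mul_le_mul_of_nonneg_left (neg_abs_le (g x.2 - t x.2)) (hhM x.1).1
      have e2 := mul_le_mul_of_nonneg_right (hhM x.1).2 (abs_nonneg (g x.2 - t x.2))
      change h x.1 * t x.2 ≤ h x.1 * g x.2 + M * |g x.2 - t x.2|
      linarith
    have h3 : ∫ x : Ω × Ω, |g x.2 - t x.2| ∂π = ∫ ω, |g ω - t ω| ∂ν := by
      rw [← hsnd, integral_map measurable_snd.aemeasurable
        (by fun_prop : Measurable _).aestronglyMeasurable]
    rw [integral_add hhg (hdiffπ.const_mul M), integral_const_mul, h3] at h2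
    change _ ≤ _ + 2 * M * ∫ ω, |g ω - t ω| ∂ν
    linarith
  have hlim := ((tendsto_integral_abs_sub_truncate hgm hgν).const_mul (2 * M)).const_add
    (∫ x : Ω × Ω, h x.1 * g x.2 ∂π)
  rw [mul_zero, add_zero] at hlim
  exact ge_of_tendsto' hlim key

/-- The transport inequality passes from bounded continuous to bounded measurable weights. -/
theorem integral_mul_le_integral_of_measurable {Ω : Type*} [TopologicalSpace Ω] [NormalSpace Ω]
    [MeasurableSpace Ω] [BorelSpace Ω] {μ : Measure Ω} [IsFiniteMeasure μ] [μ.WeaklyRegular]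
    {π : Measure (Ω × Ω)} (hfst : π.map Prod.fst = μ) {g : Ω → ℝ} (hgm : Measurable g)
    (hgμ : Integrable g μ) (hgπ : Integrable (fun x : Ω × Ω => g x.2) π) {M : ℝ} (hM : 0 ≤ M)
    (hcont : ∀ k : Ω → ℝ, Continuous k → (∀ ω, k ω ∈ Icc 0 M) →
      ∫ ω, k ω * g ω ∂μ ≤ ∫ x : Ω × Ω, k x.1 * g x.2 ∂π)
    {h : Ω → ℝ} (hm : Measurable h) (hh : ∀ ω, h ω ∈ Icc 0 M) :
    ∫ ω, h ω * g ω ∂μ ≤ ∫ x : Ω × Ω, h x.1 * g x.2 ∂π := by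
  obtain ⟨k, hkc, hkM, hk⟩ := exists_seq_continuous_tendsto_ae (μ := μ) hm hM hh
  have hkm : ∀ n, Measurable (k n) := fun n => (hkc n).measurable
  have hbound : ∀ n x r, ‖k n x * r‖ ≤ M * |r| := fun n x r => by
    rw [norm_mul, Real.norm_eq_abs, Real.norm_eq_abs, abs_of_nonneg (hkM n x).1]
    exact mul_le_mul_of_nonneg_right (hkM n x).2 (abs_nonneg r)
  have hkπ : ∀ᵐ x ∂π, Tendsto (fun n => k n x.1) atTop (𝓝 (h x.1)) := by
    rw [← hfst] at hk
    exact ae_of_ae_map measurable_fst.aemeasurable hk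
  have hlimμ : Tendsto (fun n => ∫ ω, k n ω * g ω ∂μ) atTop (𝓝 (∫ ω, h ω * g ω ∂μ)) := by
    refine tendsto_integral_of_dominated_convergence (fun ω => M * |g ω|)
      (fun n => ((hkm n).mul hgm).aestronglyMeasurable) (hgμ.abs.const_mul M)
      (fun n => Eventually.of_forall fun ω => hbound n ω _) ?_
    filter_upwards [hk] with ω hω using hω.mul_const _
  have hlimπ : Tendsto (fun n => ∫ x : Ω × Ω, k n x.1 * g x.2 ∂π) atTop
      (𝓝 (∫ x : Ω × Ω, h x.1 * g x.2 ∂π)) := by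
    refine tendsto_integral_of_dominated_convergence (fun x => M * |g x.2|)
      (fun n => (((hkm n).comp measurable_fst).mul (hgm.comp measurable_snd)).aestronglyMeasurable)
      (hgπ.abs.const_mul M) (fun n => Eventually.of_forall fun x => hbound n x.1 _) ?_
    filter_upwards [hkπ] with x hx using hx.mul_const _
  exact le_of_tendsto_of_tendsto' hlimμ hlimπ fun n => hcont _ (hkc n) (hkM n)

/-- generalised Strassen theorem. Given a point-separating set `G` of functions
containing the constants, with `Ω` carrying the topology `τ(G)` and separable therein, a
`τ(G)`-proper function `p ≥ c > 0` which is a pointwise supremum of a nonempty family of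
nonnegative combinations of members of `G`, dominating each `g ∈ G`, and two `p`-integrable
Radon probability measures `μ, ν` in order with respect to the lattice cone generated by `G`,
there exists a Radon `𝓕`-transport `π` between `μ` and `ν`. -/
theorem stmt_0 {Ω : Type*} [tΩ : TopologicalSpace Ω] [mΩ : MeasurableSpace Ω] [BorelSpace Ω]
    [TopologicalSpace.SeparableSpace Ω]
    (G : Set (Ω → ℝ))
    (htop : tΩ = ⨅ g ∈ G, TopologicalSpace.induced g inferInstance)
    (hconst : ∀ c : ℝ, (fun _ : Ω => c) ∈ G)
    (hsep : ∀ ω₁ ω₂ : Ω, ω₁ ≠ ω₂ → ∃ g ∈ G, g ω₁ ≠ g ω₂)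
    (p : Ω → ℝ)
    (hplb : ∃ c : ℝ, 0 < c ∧ ∀ ω, c ≤ p ω)
    (hproper : ∀ K : Set ℝ, IsCompact K → IsCompact (p ⁻¹' K))
    (hpsup : ∃ S : Set (Ω → ℝ), S.Nonempty ∧ S ⊆ nonnegCombos G ∧
      ∀ ω, IsLUB ((fun f : Ω → ℝ => f ω) '' S) (p ω))
    (hgrow : ∀ g ∈ G, ∃ C : ℝ, 0 < C ∧ ∀ ω, |g ω| ≤ C * p ω)
    (μ ν : Measure Ω) [IsProbabilityMeasure μ] [IsProbabilityMeasure ν]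
    (hμreg : μ.InnerRegular) (hνreg : ν.InnerRegular)
    (hpμ : Integrable p μ) (hpν : Integrable p ν)
    (horder : ∀ f ∈ latticeCone G, ∫ ω, f ω ∂μ ≤ ∫ ω, f ω ∂ν) :
    ∃ π : Measure (Ω × Ω), IsProbabilityMeasure π ∧ π.InnerRegular ∧
      π.map Prod.fst = μ ∧ π.map Prod.snd = ν ∧
      ∀ g ∈ G, ∀ h : Ω → ℝ, Measurable h → (∀ ω, 0 ≤ h ω) →
        (∃ M : ℝ, ∀ ω, h ω ≤ M) →
        ∫ ω, h ω * g ω ∂μ ≤ ∫ x : Ω × Ω, h x.1 * g x.2 ∂π := by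
  have : Nonempty Ω := nonempty_of_isProbabilityMeasure μ
  have hGc : ∀ g ∈ G, Continuous g := fun g hg => continuous_iff_le_induced.2 <| by
    rw [htop]
    exact iInf₂_le g hg
  have : CompletelyRegularSpace Ω := completelyRegularSpace_of_eq_iInf_induced htop
  have : T2Space Ω := ⟨fun x y hxy => by
    obtain ⟨g, hg, hne⟩ := hsep x y hxy
    exact separated_by_continuous (hGc g hg) hne⟩
  have : T35Space Ω := {}
  have : SigmaCompactSpace Ω := sigmaCompactSpace_of_isCompact_preimage hproper
  have : T4Space Ω := {}
  have hint : ∀ {κ : Measure Ω}, Integrable p κ → ∀ g ∈ G, Integrable g κ := by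
    intro κ hpκ g hg
    obtain ⟨C, -, hC⟩ := hgrow g hg
    exact (hpκ.const_mul C).mono' (hGc g hg).measurable.aestronglyMeasurable
      (Eventually.of_forall hC)
  obtain ⟨Λ, hΛ⟩ := exists_linearMap_nonneg_of_isTangentFamily hconst (hint hpμ) (hint hpν) horder
  have hdom : ∀ (φ : Ω × Ω →ᵇ ℝ) (a b : Ω →ᵇ ℝ), (∀ x y, φ (x, y) ≤ a x + b y) →
      Λ φ ≤ ∫ ω, a ω ∂μ + ∫ ω, b ω ∂ν := by
    intro φ a b h
    have := hΛ _ a b (-φ) (.zero hconst) a.continuous (a.integrable μ) b.continuous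
      (b.integrable ν) fun x y => by
        rw [BoundedContinuousFunction.coe_neg, Pi.neg_apply]
        linarith [h x y]
    rw [map_neg] at this
    linarith
  have hpos : ∀ φ : Ω × Ω →ᵇ ℝ, (∀ x, 0 ≤ φ x) → 0 ≤ Λ φ := by
    intro φ hφ
    simpa using hΛ _ (fun _ => 0) (fun _ => 0) φ (.zero hconst) continuous_const
      (integrable_zero _ _ _) continuous_const (integrable_zero _ _ _) fun x y => by
        simpa using hφ (x, y)
  obtain ⟨π, hπfin, hπreg, hπ⟩ := exists_innerRegular_integral_eq_of_tight
    prod_le_borel_prod Λ hpos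
    fun ε hε => exists_isCompact_forall_le_of_marginals (μ := μ) (ν := ν) hdom hε
  have hmarg : ∀ {f : Ω × Ω → Ω} (hf : Continuous f) (hfm : Measurable f) {κ : Measure Ω}
      [IsFiniteMeasure κ] [κ.InnerRegular],
      (∀ a : Ω →ᵇ ℝ, Λ (a.compContinuous ⟨f, hf⟩) ≤ ∫ ω, a ω ∂κ) → π.map f = κ := by
    intro f hf hfm κ _ _ h
    have : (π.map f).InnerRegular := innerRegular_map_of_continuous hf hfm
    refine ext_of_forall_integral_eq_of_innerRegular fun a => ?_
    rw [integral_map hfm.aemeasurable a.continuous.measurable.aestronglyMeasurable]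
    refine (hπ (a.compContinuous ⟨f, hf⟩) (a.continuous.measurable.comp hfm)).trans
      (le_antisymm (h a) ?_)
    have hneg := h (-a)
    rw [show (-a).compContinuous ⟨f, hf⟩ = -a.compContinuous ⟨f, hf⟩ from rfl, map_neg] at hneg
    simp only [BoundedContinuousFunction.coe_neg, Pi.neg_apply, integral_neg] at hneg
    linarith
  have hfst : π.map Prod.fst = μ := hmarg continuous_fst measurable_fst fun a => by
    simpa using hdom (a.compContinuous ⟨Prod.fst, continuous_fst⟩) a 0 fun x y => by simp
  have hsnd : π.map Prod.snd = ν := hmarg continuous_snd measurable_snd fun a => by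
    simpa using hdom (a.compContinuous ⟨Prod.snd, continuous_snd⟩) 0 a fun x y => by simp
  refine ⟨π, ⟨?_⟩, hπreg, hfst, hsnd, fun g hg h hm h0 ⟨M, hM⟩ => ?_⟩
  · rw [← preimage_univ (f := Prod.fst), ← Measure.map_apply measurable_fst .univ, hfst,
      measure_univ]
  · have hgπ : Integrable (fun x : Ω × Ω => g x.2) π := by
      have := hint hpν g hg
      rw [← hsnd] at this
      exact this.comp_measurable measurable_snd
    obtain ⟨ω₀⟩ := ‹Nonempty Ω›
    exact integral_mul_le_integral_of_measurable hfst (hGc g hg).measurable (hint hpμ g hg) hgπ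
      ((h0 ω₀).trans (hM ω₀))
      (fun k hk hkM => integral_mul_le_integral_of_continuous hconst hΛ hπ hsnd hg (hGc g hg)
        (hint hpμ g hg) (hint hpν g hg) hk hkM) hm fun ω => ⟨h0 ω, hM ω⟩
end

section
/- Let Ω ⊆ ℝⁿ be a nonempty open set. Call a continuous function a : Ω → ℝ harmonic if for every ω ∈ Ω and every r > 0 such that the closed ball B(ω,r) is contained in Ω, a(ω) equals the average of a over B(ω,r) with respect to Lebesgue measure. Let p : Ω → ℝ be a continuous nonnegative function which is proper (preimages of compact subsets of ℝ are compact in Ω), which is the pointwise supremum of a family of harmonic functions on Ω, and such that every linear functional ℓ on ℝⁿ satisfies |ℓ(ω)| ≤ C_ℓ·(p(ω)+1) on Ω for some constant C_ℓ > 0. Let μ and ν be Radon probability measures on Ω with ∫ p dμ < ∞ and ∫ p dν < ∞, and assume that ∫ f dμ ≤ ∫ f dν for every f which is a pointwise maximum of finitely many harmonic functions on Ω, each of (p+1)-growth. Then there exists a Radon probability measure π on Ω × Ω whose first marginal is μ and second marginal is ν, such that for every f which is a pointwise maximum of finitely many harmonic functions of (p+1)-growth and every bounded nonnegative Borel measurable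 h : Ω → ℝ one has ∫_Ω h(ω₁) f(ω₁) dμ(ω₁) ≤ ∫_{Ω×Ω} h(ω₁) f(ω₂) dπ(ω₁,ω₂). -/
open MeasureTheory Metric

/-- A continuous function on an open set `Ω ⊆ ℝⁿ` is harmonic if its value at each point
equals its average over every closed ball contained in `Ω` centred at that point. -/
def IsHarmonicOn {n : ℕ} (Ω : Set (EuclideanSpace ℝ (Fin n)))
    (a : EuclideanSpace ℝ (Fin n) → ℝ) : Prop :=
  ContinuousOn a Ω ∧ ∀ ω ∈ Ω, ∀ r : ℝ, 0 < r → closedBall ω r ⊆ Ω →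
    a ω = ⨍ x in closedBall ω r, a x

section Transport

open Filter Topology CompactlySupported

section PositiveExtension

/-- A functional `ℓ` that is nonnegative on the vectors which `ι` sends into a cone `K` factors
through `ι` as a `K`-nonnegative functional, provided the range of `ι` dominates everything. -/
theorem exists_nonneg_extension {V E : Type*} [AddCommGroup V] [Module ℝ V] [AddCommGroup E]
    [Module ℝ E] (K : PointedCone ℝ E) (ι : V →ₗ[ℝ] E) (ℓ : V →ₗ[ℝ] ℝ)
    (hpos : ∀ v, ι v ∈ K → 0 ≤ ℓ v) (hmaj : ∀ Φ, ∃ v, ι v + Φ ∈ K) :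
    ∃ Λ : E →ₗ[ℝ] ℝ, (∀ Φ ∈ K, 0 ≤ Λ Φ) ∧ ∀ v, Λ (ι v) = ℓ v := by
  let S : V × E →ₗ[ℝ] E := ι.coprod LinearMap.id
  let D : Submodule ℝ (V × E) := LinearMap.ker (LinearMap.snd ℝ V E)
  have hS : ∀ v Φ, S (v, Φ) = ι v + Φ := fun v Φ => by simp [S]
  obtain ⟨g, hg, hgs⟩ := riesz_extension (K.comap S) ((ℓ.comp (LinearMap.fst ℝ V E)).toPMap D)
    (by
      rintro ⟨⟨v, Φ⟩, hv⟩ hx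
      obtain rfl : Φ = 0 := hv
      refine hpos v ?_
      have : S (v, 0) ∈ K := hx
      simpa [hS] using this)
    (by
      rintro ⟨v, Φ⟩
      obtain ⟨w, hw⟩ := hmaj Φ
      refine ⟨⟨(w - v, 0), by simp [D]⟩, ?_⟩
      change S ((w - v, 0) + (v, Φ)) ∈ K
      simpa [hS] using hw)
  have hgv : ∀ v, g (v, 0) = ℓ v := fun v => hg ⟨(v, 0), by simp [D]⟩
  refine ⟨g.comp (LinearMap.inr ℝ V E), fun Φ hΦ => hgs _ ?_, fun v => ?_⟩
  · change S (0, Φ) ∈ K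
    simpa [hS] using hΦ
  · have h₁ : 0 ≤ g (v, -ι v) := hgs _ (by
      change S (v, -ι v) ∈ K
      simp [hS])
    have h₂ : 0 ≤ g (-v, ι v) := hgs _ (by
      change S (-v, ι v) ∈ K
      simp [hS])
    have e₁ : g (v, -ι v) = ℓ v - g (0, ι v) := by
      rw [← hgv, ← map_sub]; simp
    have e₂ : g (-v, ι v) = g (0, ι v) - ℓ v := by
      rw [← hgv, ← map_sub]; simp
    change g (0, ι v) = ℓ v
    linarith

end PositiveExtension

section Growth

variable {Z : Type*} [TopologicalSpace Z]

/-- A version of `exists_nonneg_extension` for a subspace spanned by the images of two maps. -/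
theorem exists_nonneg_extension₂ {V W E : Type*} [AddCommGroup V] [Module ℝ V] [AddCommGroup W]
    [Module ℝ W] [AddCommGroup E] [Module ℝ E] (K : PointedCone ℝ E) (ι₁ : V →ₗ[ℝ] E)
    (ι₂ : W →ₗ[ℝ] E) (ℓ₁ : V →ₗ[ℝ] ℝ) (ℓ₂ : W →ₗ[ℝ] ℝ)
    (hpos : ∀ v w, ι₁ v + ι₂ w ∈ K → 0 ≤ ℓ₁ v + ℓ₂ w)
    (hmaj : ∀ Φ, ∃ v w, ι₁ v + ι₂ w + Φ ∈ K) :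
    ∃ Λ : E →ₗ[ℝ] ℝ, (∀ Φ ∈ K, 0 ≤ Λ Φ) ∧ (∀ v, Λ (ι₁ v) = ℓ₁ v) ∧ ∀ w, Λ (ι₂ w) = ℓ₂ w := by
  obtain ⟨Λ, hΛ, h⟩ := exists_nonneg_extension K (ι₁.coprod ι₂) (ℓ₁.coprod ℓ₂)
    (fun v hv => by simpa using hpos v.1 v.2 (by simpa using hv))
    (fun Φ => by
      obtain ⟨v, w, hvw⟩ := hmaj Φ
      exact ⟨(v, w), by simpa using hvw⟩)
  exact ⟨Λ, hΛ, fun v => by simpa using h (v, 0), fun w => by simpa using h (0, w)⟩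

/-- Continuous functions of `P`-growth. -/
def growth (P : Z → ℝ) : Submodule ℝ C(Z, ℝ) where
  carrier := {f | ∃ C, ∀ z, |f z| ≤ C * P z}
  add_mem' := by
    rintro f g ⟨C, hC⟩ ⟨D, hD⟩
    refine ⟨C + D, fun z => (abs_add_le _ _).trans ?_⟩
    rw [add_mul]
    exact add_le_add (hC z) (hD z)
  zero_mem' := ⟨0, by simp⟩
  smul_mem' := by
    rintro c f ⟨C, hC⟩
    refine ⟨|c| * C, fun z => ?_⟩
    rw [ContinuousMap.smul_apply, smul_eq_mul, abs_mul, mul_assoc]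
    exact mul_le_mul_of_nonneg_left (hC z) (abs_nonneg c)

theorem exists_pos_growth_bound {P : Z → ℝ} (hP : ∀ z, 1 ≤ P z) (f : growth P) :
    ∃ C, 0 < C ∧ ∀ z, |f.1 z| ≤ C * P z := by
  obtain ⟨C, hC⟩ := f.2
  refine ⟨max C 1, by positivity, fun z => (hC z).trans ?_⟩
  exact mul_le_mul_of_nonneg_right (le_max_left _ _) (by linarith [hP z])

theorem mul_mem_growth {P : Z → ℝ} {f g : C(Z, ℝ)} {M : ℝ} (hf : ∀ z, |f z| ≤ M)
    (hg : g ∈ growth P) : f * g ∈ growth P := by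
  obtain ⟨C, hC⟩ := hg
  refine ⟨M * C, fun z => ?_⟩
  rw [ContinuousMap.mul_apply, abs_mul, mul_assoc]
  exact mul_le_mul (hf z) (hC z) (abs_nonneg _) ((abs_nonneg _).trans (hf z))

/-- The continuous function equal to `1` on `{P ≤ m}` and to `0` on `{P ≥ m + 1}`. -/
def cutoff (P : C(Z, ℝ)) (m : ℕ) : C(Z, ℝ) where
  toFun z := max 0 (min 1 (m + 1 - P z))

variable {P : C(Z, ℝ)}

theorem cutoff_nonneg (m : ℕ) (z : Z) : 0 ≤ cutoff P m z := le_max_left _ _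

theorem cutoff_le_one (m : ℕ) (z : Z) : cutoff P m z ≤ 1 :=
  max_le zero_le_one (min_le_left _ _)

theorem abs_cutoff_le_one (m : ℕ) (z : Z) : |cutoff P m z| ≤ 1 :=
  abs_le.2 ⟨by linarith [cutoff_nonneg (P := P) m z], cutoff_le_one m z⟩

theorem cutoff_eq_one {m : ℕ} {z : Z} (h : P z ≤ m) : cutoff P m z = 1 := by
  change max 0 (min 1 ((m : ℝ) + 1 - P z)) = 1
  rw [min_eq_left (by linarith), max_eq_right zero_le_one]

theorem tendsto_cutoff (z : Z) : Tendsto (fun m => cutoff P m z) atTop (𝓝 1) := by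
  obtain ⟨N, hN⟩ := exists_nat_ge (P z)
  refine tendsto_const_nhds.congr' ?_
  filter_upwards [eventually_ge_atTop N] with m hm
  exact (cutoff_eq_one (hN.trans (by exact_mod_cast hm))).symm

theorem hasCompactSupport_cutoff_mul [R1Space Z] (hP : ∀ c : ℝ, IsCompact {z | P z ≤ c}) (m : ℕ)
    (f : C(Z, ℝ)) : HasCompactSupport (cutoff P m * f) := by
  refine HasCompactSupport.of_support_subset_isCompact (hP (m + 1)) fun z hz => ?_
  by_contra h
  simp only [Set.mem_ofPred_eq, not_le] at h
  refine hz ?_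
  change max 0 (min 1 ((m : ℝ) + 1 - P z)) * f z = 0
  rw [max_eq_left ((min_le_right _ _).trans (by linarith)), zero_mul]

/-- Multiplication by the cutoff, on functions of `P`-growth. -/
def truncate (P : C(Z, ℝ)) (m : ℕ) (f : growth P) : growth P :=
  ⟨cutoff P m * f.1, mul_mem_growth (abs_cutoff_le_one m) f.2⟩

theorem truncate_apply (m : ℕ) (f : growth P) (z : Z) :
    (truncate P m f).1 z = cutoff P m z * f.1 z := rfl

/-- The weight `P` as a function of `P`-growth. -/
def growthWeight (P : C(Z, ℝ)) (hP : ∀ z, 1 ≤ P z) : growth P :=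
  ⟨P, 1, fun z => by rw [one_mul, abs_of_nonneg (by linarith [hP z])]⟩

/-- A positive functional on functions of `P`-growth which is tight, in the sense that it is
continuous along truncations of `P`, is integration against a measure. -/
theorem exists_measure_of_tight [T2Space Z] [LocallyCompactSpace Z] [MeasurableSpace Z]
    [BorelSpace Z] (hP1 : ∀ z, 1 ≤ P z) (hP : ∀ c : ℝ, IsCompact {z | P z ≤ c})
    (Λ : growth P →ₗ[ℝ] ℝ) (hΛ : ∀ f : growth P, (∀ z, 0 ≤ f.1 z) → 0 ≤ Λ f)
    (htight : Tendsto (fun m => Λ (growthWeight P hP1 - truncate P m (growthWeight P hP1)))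
      atTop (𝓝 0)) :
    ∃ π : Measure Z, ∀ f : growth P, Integrable f.1 π ∧ ∫ z, f.1 z ∂π = Λ f := by
  have hmem : ∀ f : C(Z, ℝ), HasCompactSupport f → f ∈ growth P := by
    intro f hf
    obtain ⟨C, hC⟩ := hf.exists_bound_of_continuous f.continuous
    refine ⟨C, fun z => (hC z).trans ?_⟩
    exact le_mul_of_one_le_right ((norm_nonneg _).trans (hC z)) (hP1 z)
  let L : C_c(Z, ℝ) →ₗ[ℝ] growth P :=
    { toFun := fun f => ⟨f.toContinuousMap, hmem _ f.hasCompactSupport'⟩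
      map_add' := fun f g => rfl
      map_smul' := fun c f => rfl }
  let Λc : C_c(Z, ℝ) →ₚ[ℝ] ℝ :=
    { toLinearMap := Λ.comp L
      monotone' := fun f g hfg => by
        have h := hΛ (L g - L f) fun z => sub_nonneg.2 (hfg z)
        rw [map_sub] at h
        exact sub_nonneg.1 h }
  have htr : ∀ (f : growth P) (m : ℕ), Integrable (truncate P m f).1 (RealRMK.rieszMeasure Λc) ∧
      ∫ z, (truncate P m f).1 z ∂(RealRMK.rieszMeasure Λc) = Λ (truncate P m f) := by
    intro f m
    have hc := hasCompactSupport_cutoff_mul hP m f.1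
    exact ⟨(truncate P m f).1.continuous.integrable_of_hasCompactSupport hc,
      RealRMK.integral_rieszMeasure Λc ⟨(truncate P m f).1, hc⟩⟩
  have hlim : ∀ f : growth P, Tendsto (fun m => Λ (truncate P m f)) atTop (𝓝 (Λ f)) := by
    intro f
    obtain ⟨C, hC0, hC⟩ := exists_pos_growth_bound hP1 f
    rw [tendsto_iff_norm_sub_tendsto_zero]
    have hz : Tendsto (fun m => C * Λ (growthWeight P hP1 - truncate P m (growthWeight P hP1)))
        atTop (𝓝 0) := by simpa using htight.const_mul C
    refine squeeze_zero (fun m => norm_nonneg _) (fun m => ?_) hz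
    have key : ∀ z, |(1 - cutoff P m z) * f.1 z| ≤ C * ((1 - cutoff P m z) * P z) := by
      intro z
      have h1 := cutoff_le_one (P := P) m z
      rw [abs_mul, abs_of_nonneg (by linarith), mul_left_comm]
      exact mul_le_mul_of_nonneg_left (hC z) (by linarith)
    have h₁ := hΛ (C • (growthWeight P hP1 - truncate P m (growthWeight P hP1))
      - (truncate P m f - f)) fun z => by
        change 0 ≤ C * (P z - cutoff P m z * P z) - (cutoff P m z * f.1 z - f.1 z)
        linarith [(abs_le.1 (key z)).1]
    have h₂ := hΛ (C • (growthWeight P hP1 - truncate P m (growthWeight P hP1))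
      + (truncate P m f - f)) fun z => by
        change 0 ≤ C * (P z - cutoff P m z * P z) + (cutoff P m z * f.1 z - f.1 z)
        linarith [(abs_le.1 (key z)).2]
    rw [map_sub, map_smul, map_sub Λ (truncate P m f), smul_eq_mul] at h₁
    rw [map_add, map_smul, map_sub Λ (truncate P m f), smul_eq_mul] at h₂
    rw [Real.norm_eq_abs]
    exact abs_le.2 ⟨by linarith, by linarith⟩
  refine ⟨RealRMK.rieszMeasure Λc, ?_⟩
  have hPint : Integrable P (RealRMK.rieszMeasure Λc) := by
    refine ⟨P.continuous.measurable.aestronglyMeasurable, ?_⟩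
    have hfatou := lintegral_liminf_le (u := atTop) (μ := RealRMK.rieszMeasure Λc)
      (f := fun m z => ENNReal.ofReal ((truncate P m (growthWeight P hP1)).1 z))
      fun m => (ContinuousMap.continuous _).measurable.ennreal_ofReal
    have hl : ∀ z, liminf (fun m => ENNReal.ofReal ((truncate P m (growthWeight P hP1)).1 z)) atTop
        = ‖P z‖ₑ := by
      intro z
      have : Tendsto (fun m => cutoff P m z * P z) atTop (𝓝 (P z)) := by
        simpa using (tendsto_cutoff z).mul_const (P z)
      rw [Real.enorm_eq_ofReal (by linarith [hP1 z])]
      exact ((ENNReal.continuous_ofReal.tendsto _).comp this).liminf_eq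
    simp only [hl] at hfatou
    refine lt_of_le_of_lt hfatou ?_
    have : ∀ m, ∫⁻ z, ENNReal.ofReal ((truncate P m (growthWeight P hP1)).1 z)
        ∂(RealRMK.rieszMeasure Λc) = ENNReal.ofReal (Λ (truncate P m (growthWeight P hP1))) := by
      intro m
      rw [← (htr _ m).2, ofReal_integral_eq_lintegral_ofReal (htr _ m).1]
      exact ae_of_all _ fun z => mul_nonneg (cutoff_nonneg m z) (by linarith [hP1 z] : 0 ≤ P z)
    simp only [this]
    exact ((ENNReal.continuous_ofReal.tendsto _).comp (hlim _)).liminf_eq.trans_lt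
      ENNReal.ofReal_lt_top
  intro f
  obtain ⟨C, hC0, hC⟩ := exists_pos_growth_bound hP1 f
  have hb : Integrable (fun z => C * P z) (RealRMK.rieszMeasure Λc) := hPint.const_mul C
  refine ⟨hb.mono' f.1.continuous.measurable.aestronglyMeasurable (ae_of_all _ hC), ?_⟩
  refine tendsto_nhds_unique ?_ (hlim f)
  simp only [← (htr f _).2]
  refine tendsto_integral_of_dominated_convergence _
    (fun m => (ContinuousMap.continuous _).measurable.aestronglyMeasurable) hb
    (fun m => ae_of_all _ fun z => ?_) (ae_of_all _ fun z => ?_)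
  · rw [truncate_apply, norm_mul]
    exact (mul_le_of_le_one_left (norm_nonneg _) (abs_cutoff_le_one m z)).trans (hC z)
  · simpa [truncate_apply] using (tendsto_cutoff (P := P) z).mul_const (f.1 z)

end Growth

section Coupling

variable {X : Type*} [TopologicalSpace X]

/-- Precomposition with a continuous map that is compatible with the weights. -/
def growthComp {Y Z : Type*} [TopologicalSpace Y] [TopologicalSpace Z] {P : Z → ℝ} {Q : Y → ℝ}
    (hP : ∀ z, 1 ≤ P z) (g : C(Y, Z)) {c : ℝ} (hg : ∀ y, P (g y) ≤ c * Q y) :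
    growth P →ₗ[ℝ] growth Q where
  toFun f := ⟨f.1.comp g, by
    obtain ⟨C, hC0, hC⟩ := exists_pos_growth_bound hP f
    refine ⟨C * c, fun y => (hC (g y)).trans ?_⟩
    rw [mul_assoc]
    exact mul_le_mul_of_nonneg_left (hg y) hC0.le⟩
  map_add' _ _ := rfl
  map_smul' _ _ := rfl

theorem integrable_of_mem_growth [MeasurableSpace X] [OpensMeasurableSpace X] {q : X → ℝ}
    {μ : Measure X} (hq : Integrable q μ) (f : growth q) : Integrable f.1 μ := by
  obtain ⟨C, hC⟩ := f.2
  exact (hq.const_mul C).mono' f.1.continuous.measurable.aestronglyMeasurable (ae_of_all _ hC)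

/-- Integration as a functional on functions of `q`-growth. -/
noncomputable def growthIntegral [MeasurableSpace X] [OpensMeasurableSpace X] {q : X → ℝ}
    {μ : Measure X} (hq : Integrable q μ) : growth q →ₗ[ℝ] ℝ where
  toFun f := ∫ x, f.1 x ∂μ
  map_add' f g := integral_add (integrable_of_mem_growth hq f) (integrable_of_mem_growth hq g)
  map_smul' c _ := integral_const_mul c _

/-- The cone of nonnegative functions of `P`-growth. -/
def growthCone {Z : Type*} [TopologicalSpace Z] (P : Z → ℝ) : PointedCone ℝ (growth P) where
  carrier := {f | ∀ z, 0 ≤ f.1 z}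
  add_mem' hf hg z := add_nonneg (hf z) (hg z)
  zero_mem' _ := le_rfl
  smul_mem' c _ hf z := mul_nonneg c.2 (hf z)

/-- The weight `(x, y) ↦ q x + q y`. -/
def sumWeight (q : C(X, ℝ)) : C(X × X, ℝ) where
  toFun z := q z.1 + q z.2

/-- Functions on the product all of whose sections in the second variable lie in `A`. -/
def sectionsIn (A : Submodule ℝ C(X, ℝ)) (P : X × X → ℝ) : Submodule ℝ (growth P) where
  carrier := {t | ∀ x, t.1.curry x ∈ A}
  add_mem' hs ht x := A.add_mem (hs x) (ht x)
  zero_mem' _ := A.zero_mem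
  smul_mem' c _ ht x := A.smul_mem c (ht x)

/-- If every finite maximum of functions in `A` has a smaller `μ`- than `ν`-integral, then the
pair `(ψ, t)` has a nonnegative dual value as soon as `0 ≤ ψ y + t (x, y)` everywhere. -/
theorem dual_value_nonneg [SecondCountableTopology X] [MeasurableSpace X] [OpensMeasurableSpace X]
    {μ ν : Measure X} [IsProbabilityMeasure μ] {A : Submodule ℝ C(X, ℝ)}
    (hAμ : ∀ a ∈ A, Integrable a μ) (hAν : ∀ a ∈ A, Integrable a ν)
    (horder : ∀ (k : ℕ) (a : Fin (k + 1) → C(X, ℝ)), (∀ i, a i ∈ A) →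
      ∫ x, Finset.univ.sup' Finset.univ_nonempty (fun i => a i x) ∂μ ≤
        ∫ x, Finset.univ.sup' Finset.univ_nonempty (fun i => a i x) ∂ν)
    (ψ : X → ℝ) (hψ : Integrable ψ ν) (t : C(X × X, ℝ)) (ht : ∀ x, t.curry x ∈ A)
    (htd : Integrable (fun x => t (x, x)) μ) (hpos : ∀ x y, 0 ≤ ψ y + t (x, y)) :
    0 ≤ ∫ y, ψ y ∂ν + ∫ x, t (x, x) ∂μ := by
  have : Nonempty X := nonempty_of_isProbabilityMeasure μ
  let d := TopologicalSpace.denseSeq X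
  let a : ℕ → C(X, ℝ) := fun j => -t.curry (d j)
  have ha : ∀ j, a j ∈ A := fun j => A.neg_mem (ht _)
  have haψ : ∀ j y, a j y ≤ ψ y := fun j y => by
    change -t (d j, y) ≤ ψ y
    linarith [hpos (d j) y]
  let F : ℕ → X → ℝ := fun k x =>
    Finset.univ.sup' Finset.univ_nonempty (fun i : Fin (k + 1) => a i x)
  have hFi : ∀ (ρ : Measure X), (∀ j, Integrable (a j) ρ) → ∀ k, Integrable (F k) ρ := by
    intro ρ hρ k
    have := Finset.sup'_induction (p := fun f : X → ℝ => Integrable f ρ)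
      (Finset.univ_nonempty (α := Fin (k + 1)))
      (fun i => (a i : X → ℝ)) (fun f hf g hg => hf.sup hg) (fun i _ => hρ i)
    refine this.congr (ae_of_all _ fun x => ?_)
    simp only [F, Finset.sup'_apply]
  have hFμ := hFi μ fun j => hAμ _ (ha j)
  have hFν := hFi ν fun j => hAν _ (ha j)
  have hFψ : ∀ k, ∫ x, F k x ∂μ ≤ ∫ y, ψ y ∂ν := fun k =>
    (horder k (fun i => a i) fun i => ha i).trans
      (integral_mono (hFν k) hψ fun y => Finset.sup'_le _ _ fun i _ => haψ i y)
  have hF0 : ∀ k x, a 0 x ≤ F k x := fun k x =>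
    Finset.le_sup' (fun i : Fin (k + 1) => a i x) (Finset.mem_univ 0)
  let G : ℕ → X → ℝ := fun k x => min (F k x) (-t (x, x))
  have hGF : ∀ k, Integrable (G k) μ := fun k => (hFμ k).inf htd.neg
  have hG : Tendsto (fun k => ∫ x, G k x ∂μ) atTop (𝓝 (∫ x, -t (x, x) ∂μ)) := by
    refine tendsto_integral_of_dominated_convergence (fun x => |a 0 x| + |t (x, x)|)
      (fun k => (hGF k).1) ((hAμ _ (ha 0)).abs.add htd.abs)
      (fun k => ae_of_all _ fun x => ?_) (ae_of_all _ fun x => ?_)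
    · refine abs_le.2 ⟨le_min ?_ ?_, (min_le_right _ _).trans ?_⟩
      · linarith [hF0 k x, neg_abs_le (a 0 x), abs_nonneg (t (x, x))]
      · linarith [le_abs_self (t (x, x)), abs_nonneg (a 0 x)]
      · linarith [neg_abs_le (t (x, x)), abs_nonneg (a 0 x)]
    · refine tendsto_order.2 ⟨fun c hc => ?_, fun c hc =>
        Eventually.of_forall fun k => (min_le_right _ _).trans_lt hc⟩
      have hopen : IsOpen {x' : X | c < -t (x', x)} :=
        isOpen_lt continuous_const (by fun_prop)
      obtain ⟨j, hj⟩ := (TopologicalSpace.denseRange_denseSeq X).exists_mem_open hopen ⟨x, hc⟩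
      filter_upwards [eventually_ge_atTop j] with k hk
      refine lt_min (lt_of_lt_of_le (b := a j x) hj ?_) hc
      exact Finset.le_sup' (fun i : Fin (k + 1) => a i x)
        (Finset.mem_univ (⟨j, Nat.lt_succ_of_le hk⟩ : Fin (k + 1)))
  have := le_of_tendsto' hG fun k =>
    (integral_mono (hGF k) (hFμ k) fun x => min_le_left _ _).trans (hFψ k)
  rw [integral_neg] at this
  linarith

variable {q : C(X, ℝ)}

theorem one_le_sumWeight (hq1 : ∀ x, 1 ≤ q x) (z : X × X) : 1 ≤ sumWeight q z := by
  change 1 ≤ q z.1 + q z.2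
  linarith [hq1 z.1, hq1 z.2]

theorem isCompact_sumWeight_le (hq1 : ∀ x, 1 ≤ q x)
    (hqc : ∀ c : ℝ, IsCompact {x | q x ≤ c}) (c : ℝ) :
    IsCompact {z | sumWeight q z ≤ c} := by
  refine ((hqc c).prod (hqc c)).of_isClosed_subset
    (isClosed_le (sumWeight q).continuous continuous_const) fun z hz => ?_
  have hz' : q z.1 + q z.2 ≤ c := hz
  exact ⟨show q z.1 ≤ c by linarith [hq1 z.2], show q z.2 ≤ c by linarith [hq1 z.1]⟩

/-- Functions of the first variable, as functions on the product. -/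
def growthFst (hq1 : ∀ x, 1 ≤ q x) : growth q →ₗ[ℝ] growth (sumWeight q) :=
  growthComp hq1 ContinuousMap.fst (c := 1) fun z => by
    change q z.1 ≤ 1 * (q z.1 + q z.2)
    linarith [hq1 z.2]

/-- Functions of the second variable, as functions on the product. -/
def growthSnd (hq1 : ∀ x, 1 ≤ q x) : growth q →ₗ[ℝ] growth (sumWeight q) :=
  growthComp hq1 ContinuousMap.snd (c := 1) fun z => by
    change q z.2 ≤ 1 * (q z.1 + q z.2)
    linarith [hq1 z.1]

/-- Restriction to the diagonal. -/
def growthDiag (hq1 : ∀ x, 1 ≤ q x) : growth (sumWeight q) →ₗ[ℝ] growth q :=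
  growthComp (one_le_sumWeight hq1) ((ContinuousMap.id X).prodMk (ContinuousMap.id X)) (c := 2)
    fun x => by
      change q x + q x ≤ 2 * q x
      linarith

theorem growthFst_curry_mem (hq1 : ∀ x, 1 ≤ q x) {A : Submodule ℝ C(X, ℝ)} (hA1 : 1 ∈ A)
    (f : growth q) (x : X) :
    (growthFst hq1 f).1.curry x ∈ A := by
  have : (growthFst hq1 f).1.curry x = f.1 x • (1 : C(X, ℝ)) := by
    ext y
    change f.1 x = f.1 x * 1
    rw [mul_one]
  rw [this]
  exact A.smul_mem _ hA1

/-- The part of `q + q` above level `m`, smoothly cut off. -/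
def growthTail (hq1 : ∀ x, 1 ≤ q x) (m : ℕ) : growth q :=
  growthWeight q hq1 + growthWeight q hq1 - ⟨cutoff (q + q) m * (q + q),
    mul_mem_growth (abs_cutoff_le_one m) (growthWeight q hq1 + growthWeight q hq1).2⟩

theorem growthTail_apply (hq1 : ∀ x, 1 ≤ q x) (m : ℕ) (x : X) :
    (growthTail hq1 m).1 x = (q x + q x) - cutoff (q + q) m x * (q x + q x) := rfl

theorem growthTail_nonneg (hq1 : ∀ x, 1 ≤ q x) (m : ℕ) (x : X) : 0 ≤ (growthTail hq1 m).1 x := by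
  rw [growthTail_apply]
  nlinarith [cutoff_le_one (P := q + q) m x, hq1 x]

theorem tendsto_integral_growthTail (hq1 : ∀ x, 1 ≤ q x) [MeasurableSpace X]
    [OpensMeasurableSpace X] {ρ : Measure X}
    (hρ : Integrable q ρ) :
    Tendsto (fun m => ∫ x, (growthTail hq1 m).1 x ∂ρ) atTop (𝓝 0) := by
  rw [← integral_zero X ℝ (μ := ρ)]
  refine tendsto_integral_of_dominated_convergence (fun x => q x + q x)
    (fun m => (ContinuousMap.continuous _).measurable.aestronglyMeasurable) (hρ.add hρ)
    (fun m => ae_of_all _ fun x => ?_) (ae_of_all _ fun x => ?_)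
  · rw [Real.norm_eq_abs, abs_of_nonneg (growthTail_nonneg hq1 m x), growthTail_apply]
    nlinarith [cutoff_nonneg (P := q + q) m x, hq1 x]
  · have : Tendsto (fun m => (q x + q x) - cutoff (q + q) m x * (q x + q x)) atTop
        (𝓝 ((q x + q x) - 1 * (q x + q x))) :=
      tendsto_const_nhds.sub ((tendsto_cutoff (P := q + q) x).mul_const _)
    simpa [growthTail_apply] using this

theorem sub_cutoff_mul_sumWeight_le (hq1 : ∀ x, 1 ≤ q x) (m : ℕ) (z : X × X) :
    sumWeight q z - cutoff (sumWeight q) m z * sumWeight q z ≤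
      (growthTail hq1 m).1 z.2 + (growthTail hq1 m).1 z.1 := by
  have hcut : ∀ x, sumWeight q z ≤ q x + q x →
      sumWeight q z - cutoff (sumWeight q) m z * sumWeight q z ≤ (growthTail hq1 m).1 x := by
    intro x hx
    rw [growthTail_apply]
    have hle : cutoff (q + q) m x ≤ cutoff (sumWeight q) m z :=
      max_le_max le_rfl (min_le_min le_rfl (sub_le_sub_left hx _))
    nlinarith [cutoff_le_one (P := sumWeight q) m z, one_le_sumWeight hq1 z]
  have h₁ := growthTail_nonneg hq1 m z.1
  have h₂ := growthTail_nonneg hq1 m z.2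
  have e : sumWeight q z = q z.1 + q z.2 := rfl
  rcases le_total (q z.1) (q z.2) with hz | hz
  · linarith [hcut z.2 (by linarith)]
  · linarith [hcut z.1 (by linarith)]

/-- The functional version of Strassen's theorem, obtained from the Hahn-Banach theorem. -/
theorem exists_martingale_functional
    [SecondCountableTopology X] [MeasurableSpace X] [BorelSpace X]
    {q : C(X, ℝ)} (hq1 : ∀ x, 1 ≤ q x) {μ ν : Measure X} [IsProbabilityMeasure μ]
    (hqμ : Integrable q μ) (hqν : Integrable q ν) {A : Submodule ℝ C(X, ℝ)} (hA : A ≤ growth q)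
    (hA1 : 1 ∈ A)
    (horder : ∀ (k : ℕ) (a : Fin (k + 1) → C(X, ℝ)), (∀ i, a i ∈ A) →
      ∫ x, Finset.univ.sup' Finset.univ_nonempty (fun i => a i x) ∂μ ≤
        ∫ x, Finset.univ.sup' Finset.univ_nonempty (fun i => a i x) ∂ν) :
    ∃ Λ : growth (sumWeight q) →ₗ[ℝ] ℝ, (∀ f, (∀ z, 0 ≤ f.1 z) → 0 ≤ Λ f) ∧
      (∀ ψ, Λ (growthSnd hq1 ψ) = ∫ y, ψ.1 y ∂ν) ∧
      ∀ t, (∀ x, t.1.curry x ∈ A) → Λ t = ∫ x, t.1 (x, x) ∂μ := by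
  let ι : sectionsIn A (sumWeight q) →ₗ[ℝ] growth (sumWeight q) := Submodule.subtype _
  let ℓ : sectionsIn A (sumWeight q) →ₗ[ℝ] ℝ :=
    (growthIntegral hqμ).comp ((growthDiag hq1).comp ι)
  have key := exists_nonneg_extension₂ (W := sectionsIn A (sumWeight q))
    (growthCone (sumWeight q)) (growthSnd hq1) ι (growthIntegral hqν) ℓ
  obtain ⟨Λ, hΛ, hΛψ, hΛt⟩ := key
    (fun ψ t h => dual_value_nonneg (fun a ha => integrable_of_mem_growth hqμ ⟨a, hA ha⟩)
      (fun a ha => integrable_of_mem_growth hqν ⟨a, hA ha⟩) horder ψ.1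
      (integrable_of_mem_growth hqν ψ) t.1.1 t.2
      (integrable_of_mem_growth hqμ (growthDiag hq1 t.1)) fun x y => h (x, y))
    (fun f => by
      obtain ⟨C, -, hC⟩ := exists_pos_growth_bound (one_le_sumWeight hq1) f
      refine ⟨C • growthWeight q hq1, ⟨growthFst hq1 (C • growthWeight q hq1),
        growthFst_curry_mem hq1 hA1 _⟩, fun z => ?_⟩
      change 0 ≤ (C * q z.2 + C * q z.1) + f.1 z
      have h : |f.1 z| ≤ C * (q z.1 + q z.2) := hC z
      linarith [(abs_le.1 h).1])
  exact ⟨Λ, hΛ, hΛψ, fun t ht => hΛt ⟨t, ht⟩⟩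

/-- Strassen's theorem: if `A` is a space of continuous functions of `q`-growth containing the
constants and `μ` is below `ν` on finite maxima of functions in `A`, then there is a measure with
marginals `μ` and `ν` which is a martingale for the functions in `A`. The marginal and martingale
properties are tested against continuous functions. -/
theorem exists_martingale_measure [T2Space X] [LocallyCompactSpace X]
    [SecondCountableTopology X] [MeasurableSpace X] [BorelSpace X]
    {q : C(X, ℝ)} (hq1 : ∀ x, 1 ≤ q x) {μ ν : Measure X} [IsProbabilityMeasure μ]
    (hqμ : Integrable q μ) (hqν : Integrable q ν) {A : Submodule ℝ C(X, ℝ)} (hA : A ≤ growth q)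
    (hA1 : 1 ∈ A)
    (horder : ∀ (k : ℕ) (a : Fin (k + 1) → C(X, ℝ)), (∀ i, a i ∈ A) →
      ∫ x, Finset.univ.sup' Finset.univ_nonempty (fun i => a i x) ∂μ ≤
        ∫ x, Finset.univ.sup' Finset.univ_nonempty (fun i => a i x) ∂ν)
    (hqc : ∀ c : ℝ, IsCompact {x | q x ≤ c}) :
    ∃ π : Measure (X × X), (∀ f ∈ growth (sumWeight q), Integrable f π) ∧
      (∀ ψ ∈ growth q, ∫ z, ψ z.2 ∂π = ∫ y, ψ y ∂ν) ∧
      ∀ t ∈ growth (sumWeight q), (∀ x, t.curry x ∈ A) → ∫ z, t z ∂π = ∫ x, t (x, x) ∂μ := by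
  obtain ⟨Λ, hΛ, hΛψ, hΛT⟩ := exists_martingale_functional hq1 hqμ hqν hA hA1 horder
  have hP1 := one_le_sumWeight hq1
  have hsum := (tendsto_integral_growthTail hq1 hqν).add (tendsto_integral_growthTail hq1 hqμ)
  rw [add_zero] at hsum
  obtain ⟨π, hπ⟩ := exists_measure_of_tight hP1 (isCompact_sumWeight_le hq1 hqc) Λ hΛ (by
    refine squeeze_zero (fun m => hΛ _ fun z => ?_) (fun m => ?_) hsum
    · change 0 ≤ sumWeight q z - cutoff (sumWeight q) m z * sumWeight q z
      nlinarith [cutoff_le_one (P := sumWeight q) m z, hP1 z]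
    · have h := hΛ (growthSnd hq1 (growthTail hq1 m) + growthFst hq1 (growthTail hq1 m) -
        (growthWeight (sumWeight q) hP1 -
          truncate (sumWeight q) m (growthWeight (sumWeight q) hP1)))
        fun z => sub_nonneg.2 (sub_cutoff_mul_sumWeight_le hq1 m z)
      rw [map_sub, map_add, hΛψ, hΛT _ (growthFst_curry_mem hq1 hA1 _)] at h
      exact sub_nonneg.1 h)
  refine ⟨π, fun f hf => (hπ ⟨f, hf⟩).1, fun ψ hψ => ?_, fun t ht hts => ?_⟩
  · exact (hπ (growthSnd hq1 ⟨ψ, hψ⟩)).2.trans (hΛψ ⟨ψ, hψ⟩)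
  · exact (hπ ⟨t, ht⟩).2.trans (hΛT ⟨t, ht⟩ hts)

end Coupling

section Submartingale

/-- Integrals against the measure `b⁺ π` pushed forward along `g`. -/
theorem integral_map_withDensity_ofReal {Z X : Type*} [MeasurableSpace Z] [MeasurableSpace X]
    (π : Measure Z) {g : Z → X} (hg : Measurable g) {b : Z → ℝ} (hbm : Measurable b) {F : X → ℝ}
    (hF : Measurable F) :
    ∫ x, F x ∂((π.withDensity fun z => ENNReal.ofReal (b z)).map g) =
      ∫ z, F (g z) * max (b z) 0 ∂π := by
  rw [integral_map hg.aemeasurable hF.aestronglyMeasurable,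
    integral_withDensity_eq_integral_toReal_smul hbm.ennreal_ofReal
      (ae_of_all _ fun _ => ENNReal.ofReal_lt_top)]
  simp only [ENNReal.toReal_ofReal', smul_eq_mul, mul_comm]

/-- The identity between the `b π`-integral of `f ∘ g` and the `a μ`-integral of `f` extends from
bounded continuous to bounded measurable functions. -/
theorem integral_comp_mul_eq_of_forall_boundedContinuous {Z X : Type*} [MeasurableSpace Z]
    [TopologicalSpace X] [HasOuterApproxClosed X] [MeasurableSpace X] [BorelSpace X]
    {π : Measure Z} {μ : Measure X} {g : Z → X} (hg : Measurable g)
    {b : Z → ℝ} (hbm : Measurable b) (hb : Integrable b π)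
    {a : X → ℝ} (ham : Measurable a) (ha : Integrable a μ)
    (hab : ∀ f : BoundedContinuousFunction X ℝ, ∫ z, f (g z) * b z ∂π = ∫ x, f x * a x ∂μ)
    {h : X → ℝ} (hm : Measurable h) {M : ℝ} (hM : ∀ x, |h x| ≤ M) :
    ∫ z, h (g z) * b z ∂π = ∫ x, h x * a x ∂μ := by
  have := isFiniteMeasure_withDensity_ofReal hb.2
  have := isFiniteMeasure_withDensity_ofReal hb.neg.2
  have := isFiniteMeasure_withDensity_ofReal ha.2
  have := isFiniteMeasure_withDensity_ofReal ha.neg.2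
  let m₁ : Measure X := ((π.withDensity fun z => ENNReal.ofReal (b z)).map g) +
    (μ.withDensity fun x => ENNReal.ofReal ((-a) x)).map id
  let m₂ : Measure X := ((π.withDensity fun z => ENNReal.ofReal ((-b) z)).map g) +
    (μ.withDensity fun x => ENNReal.ofReal (a x)).map id
  have key : ∀ F : X → ℝ, Measurable F → (∃ C, ∀ x, |F x| ≤ C) →
      ∫ x, F x ∂m₁ - ∫ x, F x ∂m₂ = ∫ z, F (g z) * b z ∂π - ∫ x, F x * a x ∂μ := by
    rintro F hF ⟨C, hC⟩
    have hi : ∀ (m : Measure X) [IsFiniteMeasure m], Integrable F m := fun m _ =>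
      Integrable.of_bound hF.aestronglyMeasurable C (ae_of_all _ hC)
    have hib : ∀ c : Z → ℝ, Integrable c π → Integrable (fun z => F (g z) * c z) π := fun c hc =>
      hc.bdd_mul (hF.comp hg).aestronglyMeasurable (ae_of_all _ fun z => hC (g z))
    have hia : ∀ c : X → ℝ, Integrable c μ → Integrable (fun x => F (id x) * c x) μ := fun c hc =>
      hc.bdd_mul hF.aestronglyMeasurable (ae_of_all _ hC)
    rw [integral_add_measure (hi _) (hi _), integral_add_measure (hi _) (hi _),
      integral_map_withDensity_ofReal _ hg hbm hF, integral_map_withDensity_ofReal _ hg hbm.neg hF,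
      integral_map_withDensity_ofReal _ measurable_id ham hF,
      integral_map_withDensity_ofReal _ measurable_id ham.neg hF,
      show ∀ p q r s : ℝ, p + q - (r + s) = (p - r) - (s - q) by intros; ring,
      ← integral_sub (hib _ hb.pos_part) (hib _ hb.neg.pos_part),
      ← integral_sub (hia _ ha.pos_part) (hia _ ha.neg.pos_part)]
    simp only [← mul_sub, Pi.neg_apply, id, max_zero_sub_max_neg_zero_eq_self]
  have hm₁₂ : m₁ = m₂ := ext_of_forall_integral_eq_of_IsFiniteMeasure fun f => by
    have := key f f.continuous.measurable ⟨‖f‖, f.norm_coe_le_norm⟩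
    rwa [hab, sub_self, sub_eq_zero] at this
  have := key h hm ⟨M, hM⟩
  rw [hm₁₂, sub_self] at this
  exact sub_eq_zero.1 this.symm

/-- The functions which are submartingales for the coupling `π` started from `μ`. -/
structure IsSubmartingaleFor {X : Type*} [MeasurableSpace X] (μ : Measure X)
    (π : Measure (X × X)) (f : X → ℝ) : Prop where
  measurable : Measurable f
  integrable : Integrable f μ
  integrable_snd : Integrable (fun z => f z.2) π
  le : ∀ h : X → ℝ, Measurable h → (∀ x, 0 ≤ h x) → (∃ M, ∀ x, h x ≤ M) →
    ∫ x, h x * f x ∂μ ≤ ∫ z, h z.1 * f z.2 ∂π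

theorem IsSubmartingaleFor.sup {X : Type*} [MeasurableSpace X] {μ : Measure X}
    {π : Measure (X × X)} {f g : X → ℝ} (hf : IsSubmartingaleFor μ π f)
    (hg : IsSubmartingaleFor μ π g) : IsSubmartingaleFor μ π (f ⊔ g) where
  measurable := hf.measurable.sup hg.measurable
  integrable := hf.integrable.sup hg.integrable
  integrable_snd := hf.integrable_snd.sup hg.integrable_snd
  le h hm h0 := by
    rintro ⟨M, hM⟩
    have hs : MeasurableSet {x | g x ≤ f x} := measurableSet_le hg.measurable hf.measurable
    set s := {x | g x ≤ f x}
    have bdd : ∀ t : Set X, ∀ x, t.indicator h x ≤ M := fun t x =>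
      (Set.indicator_le_self' (fun _ _ => h0 _) x).trans (hM x)
    have nonneg : ∀ t : Set X, ∀ x, 0 ≤ t.indicator h x := fun t x =>
      Set.indicator_nonneg (fun _ _ => h0 _) x
    have hbd : ∀ t : Set X, ∀ x, ‖t.indicator h x‖ ≤ M := fun t x => by
      rw [Real.norm_eq_abs, abs_of_nonneg (nonneg t x)]
      exact bdd t x
    have iμ : ∀ t, MeasurableSet t → ∀ u : X → ℝ, Integrable u μ →
        Integrable (fun x => t.indicator h x * u x) μ := fun t ht u hu =>
      hu.bdd_mul (hm.indicator ht).aestronglyMeasurable (ae_of_all _ (hbd t))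
    have iπ : ∀ t, MeasurableSet t → ∀ u : X → ℝ, Integrable (fun z : X × X => u z.2) π →
        Integrable (fun z : X × X => t.indicator h z.1 * u z.2) π := fun t ht u hu =>
      hu.bdd_mul ((hm.indicator ht).comp measurable_fst).aestronglyMeasurable
        (ae_of_all _ fun z => hbd t z.1)
    have hsplit : ∀ x, h x = s.indicator h x + sᶜ.indicator h x := fun x =>
      (congrFun (Set.indicator_self_add_compl s h) x).symm
    calc ∫ x, h x * (f ⊔ g) x ∂μ
        = ∫ x, (s.indicator h x * f x + sᶜ.indicator h x * g x) ∂μ := by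
          refine integral_congr_ae (ae_of_all _ fun x => ?_)
          by_cases hx : x ∈ s
          · have : g x ≤ f x := hx
            simp [hx, this]
          · have : f x ≤ g x := (not_le.1 hx).le
            simp [hx, this]
      _ = ∫ x, s.indicator h x * f x ∂μ + ∫ x, sᶜ.indicator h x * g x ∂μ :=
          integral_add (iμ s hs f hf.integrable) (iμ sᶜ hs.compl g hg.integrable)
      _ ≤ ∫ z, s.indicator h z.1 * f z.2 ∂π + ∫ z, sᶜ.indicator h z.1 * g z.2 ∂π :=
          add_le_add (hf.le _ (hm.indicator hs) (nonneg s) ⟨M, bdd s⟩)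
            (hg.le _ (hm.indicator hs.compl) (nonneg sᶜ) ⟨M, bdd sᶜ⟩)
      _ = ∫ z, (s.indicator h z.1 * f z.2 + sᶜ.indicator h z.1 * g z.2) ∂π :=
          (integral_add (iπ s hs f hf.integrable_snd) (iπ sᶜ hs.compl g hg.integrable_snd)).symm
      _ ≤ ∫ z, h z.1 * (f ⊔ g) z.2 ∂π := by
          refine integral_mono ((iπ s hs f hf.integrable_snd).add
            (iπ sᶜ hs.compl g hg.integrable_snd)) ?_ fun z => ?_
          · simpa using iπ Set.univ MeasurableSet.univ (f ⊔ g)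
              (hf.integrable_snd.sup hg.integrable_snd)
          · change _ ≤ h z.1 * max (f z.2) (g z.2)
            rw [hsplit z.1, add_mul]
            exact add_le_add (mul_le_mul_of_nonneg_left (le_max_left _ _) (nonneg _ _))
              (mul_le_mul_of_nonneg_left (le_max_right _ _) (nonneg _ _))

/-- Strassen's theorem with the submartingale property for finite maxima of functions in `A`. -/
theorem exists_submartingale_coupling {X : Type*} [TopologicalSpace X] [T2Space X]
    [LocallyCompactSpace X] [SecondCountableTopology X] [HasOuterApproxClosed X]
    [MeasurableSpace X] [BorelSpace X]
    {q : C(X, ℝ)} (hq1 : ∀ x, 1 ≤ q x) {μ ν : Measure X} [IsProbabilityMeasure μ]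
    [IsProbabilityMeasure ν]
    (hqμ : Integrable q μ) (hqν : Integrable q ν) {A : Submodule ℝ C(X, ℝ)} (hA : A ≤ growth q)
    (hA1 : 1 ∈ A)
    (horder : ∀ (k : ℕ) (a : Fin (k + 1) → C(X, ℝ)), (∀ i, a i ∈ A) →
      ∫ x, Finset.univ.sup' Finset.univ_nonempty (fun i => a i x) ∂μ ≤
        ∫ x, Finset.univ.sup' Finset.univ_nonempty (fun i => a i x) ∂ν)
    (hqc : ∀ c : ℝ, IsCompact {x | q x ≤ c}) :
    ∃ π : Measure (X × X), IsProbabilityMeasure π ∧ π.map Prod.fst = μ ∧ π.map Prod.snd = ν ∧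
      ∀ (k : ℕ) (a : Fin (k + 1) → C(X, ℝ)), (∀ i, a i ∈ A) →
        ∀ h : X → ℝ, Measurable h → (∀ x, 0 ≤ h x) → (∃ M, ∀ x, h x ≤ M) →
        ∫ x, h x * Finset.univ.sup' Finset.univ_nonempty (fun i => a i x) ∂μ ≤
          ∫ z, h z.1 * Finset.univ.sup' Finset.univ_nonempty (fun i => a i z.2) ∂π := by
  obtain ⟨π, hπi, hπν, hπA⟩ := exists_martingale_measure hq1 hqμ hqν hA hA1 horder hqc
  have bdd : ∀ f : BoundedContinuousFunction X ℝ, f.toContinuousMap ∈ growth q := fun f =>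
    ⟨‖f‖, fun x => (f.norm_coe_le_norm x).trans
      (le_mul_of_one_le_right (norm_nonneg _) (hq1 x))⟩
  have : IsFiniteMeasure π := by
    have h1 : (1 : C(X × X, ℝ)) ∈ growth (sumWeight q) :=
      ⟨1, fun z => by simpa using one_le_sumWeight hq1 z⟩
    have := hπi _ h1
    exact (integrable_const_iff_isFiniteMeasure (one_ne_zero (α := ℝ))).1 this
  have hfst : π.map Prod.fst = μ := ext_of_forall_integral_eq_of_IsFiniteMeasure fun f => by
    rw [integral_map measurable_fst.aemeasurable f.continuous.measurable.aestronglyMeasurable]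
    exact hπA _ (growthFst hq1 ⟨_, bdd f⟩).2 (growthFst_curry_mem hq1 hA1 ⟨_, bdd f⟩)
  have hsnd : π.map Prod.snd = ν := ext_of_forall_integral_eq_of_IsFiniteMeasure fun f => by
    rw [integral_map measurable_snd.aemeasurable f.continuous.measurable.aestronglyMeasurable]
    exact hπν _ (bdd f)
  have hmart : ∀ a ∈ A, IsSubmartingaleFor μ π a := by
    intro a ha
    have hi : Integrable (fun z : X × X => a z.2) π := hπi _ (growthSnd hq1 ⟨a, hA ha⟩).2
    refine ⟨a.continuous.measurable, integrable_of_mem_growth hqμ ⟨a, hA ha⟩, hi, ?_⟩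
    rintro h hm h0 ⟨M, hM⟩
    refine (integral_comp_mul_eq_of_forall_boundedContinuous measurable_fst
      (a.continuous.measurable.comp measurable_snd) hi a.continuous.measurable
      (integrable_of_mem_growth hqμ ⟨a, hA ha⟩) (fun f => ?_) hm
      fun x => (abs_of_nonneg (h0 x)).trans_le (hM x)).ge
    refine hπA ((f.toContinuousMap.comp ContinuousMap.fst) * (a.comp ContinuousMap.snd))
      (mul_mem_growth (fun z => f.norm_coe_le_norm z.1) (growthSnd hq1 ⟨a, hA ha⟩).2) fun x => ?_
    exact A.smul_mem (f x) ha
  refine ⟨π, ⟨?_⟩, hfst, hsnd, fun k a ha => ?_⟩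
  · rw [← Set.preimage_univ (f := Prod.fst), ← Measure.map_apply measurable_fst MeasurableSet.univ,
      hfst, measure_univ]
  · have := Finset.sup'_induction (p := IsSubmartingaleFor μ π)
      (Finset.univ_nonempty (α := Fin (k + 1)))
      (fun i => (a i : X → ℝ)) (fun f hf g hg => hf.sup hg) (fun i _ => hmart _ (ha i))
    have := this.le
    simpa only [Finset.sup'_apply] using this

end Submartingale

section Harmonic

variable {n : ℕ} {Ω : Set (EuclideanSpace ℝ (Fin n))}

theorem IsHarmonicOn.integrableOn_closedBall {a : EuclideanSpace ℝ (Fin n) → ℝ}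
    (ha : IsHarmonicOn Ω a) {ω : EuclideanSpace ℝ (Fin n)} {r : ℝ} (h : closedBall ω r ⊆ Ω) :
    IntegrableOn a (closedBall ω r) :=
  (ha.1.mono h).integrableOn_compact (isCompact_closedBall ω r)

theorem IsHarmonicOn.add {a b : EuclideanSpace ℝ (Fin n) → ℝ} (ha : IsHarmonicOn Ω a)
    (hb : IsHarmonicOn Ω b) : IsHarmonicOn Ω (a + b) := by
  refine ⟨ha.1.add hb.1, fun ω hω r hr h => ?_⟩
  rw [Pi.add_apply, ha.2 ω hω r hr h, hb.2 ω hω r hr h, setAverage_eq, setAverage_eq,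
    setAverage_eq, ← smul_add, ← integral_add (ha.integrableOn_closedBall h)
    (hb.integrableOn_closedBall h)]
  rfl

theorem IsHarmonicOn.const_smul {a : EuclideanSpace ℝ (Fin n) → ℝ} (ha : IsHarmonicOn Ω a)
    (c : ℝ) : IsHarmonicOn Ω (c • a) := by
  refine ⟨ha.1.const_smul c, fun ω hω r hr h => ?_⟩
  rw [Pi.smul_apply, ha.2 ω hω r hr h, setAverage_eq, setAverage_eq, smul_comm, ← integral_smul]
  rfl

theorem isHarmonicOn_const (c : ℝ) : IsHarmonicOn Ω fun _ => c := by
  refine ⟨continuousOn_const, fun ω _ r hr _ => ?_⟩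
  exact (setAverage_const (measure_closedBall_pos volume ω hr).ne'
    measure_closedBall_lt_top.ne c).symm

/-- Harmonic functions of `q`-growth, as a space of continuous functions on the subtype `Ω`. -/
def harmonicGrowth (Ω : Set (EuclideanSpace ℝ (Fin n))) (q : Ω → ℝ) : Submodule ℝ C(Ω, ℝ) where
  carrier := {a | a ∈ growth q ∧ ∃ b, IsHarmonicOn Ω b ∧ ∀ ω : Ω, b ω = a ω}
  add_mem' := by
    rintro f g ⟨hf, b, hb, hbf⟩ ⟨hg, c, hc, hcg⟩
    exact ⟨(growth q).add_mem hf hg, b + c, hb.add hc, fun ω => congrArg₂ (· + ·) (hbf ω) (hcg ω)⟩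
  zero_mem' := ⟨(growth q).zero_mem, _, isHarmonicOn_const 0, fun _ => rfl⟩
  smul_mem' := by
    rintro c f ⟨hf, b, hb, hbf⟩
    exact ⟨(growth q).smul_mem c hf, c • b, hb.const_smul c, fun ω => congrArg (c * ·) (hbf ω)⟩

end Harmonic

end Transport

/-- Strassen theorem for harmonic transports. Given a nonempty open `Ω ⊆ ℝⁿ`, a
nonnegative continuous proper function `p` on `Ω` which is a pointwise supremum of harmonic
functions and dominates all linear functionals (up to `(p+1)`-growth), and `p`-integrable
Radon probability measures `μ, ν` on `Ω` ordered against all finite maxima of harmonic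
functions of `(p+1)`-growth, there exists a Radon transport `π` between `μ` and `ν` which is
a submartingale transport for all such finite maxima of harmonic functions. -/
theorem stmt_3 {n : ℕ} (Ω : Set (EuclideanSpace ℝ (Fin n)))
    (hΩo : IsOpen Ω) (hΩne : Ω.Nonempty)
    (p : EuclideanSpace ℝ (Fin n) → ℝ)
    (hpc : ContinuousOn p Ω) (hp0 : ∀ ω ∈ Ω, 0 ≤ p ω)
    (hproper : ∀ K : Set ℝ, IsCompact K → IsCompact (Ω ∩ p ⁻¹' K))
    (hpsup : ∃ S : Set (EuclideanSpace ℝ (Fin n) → ℝ), (∀ f ∈ S, IsHarmonicOn Ω f) ∧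
      ∀ ω ∈ Ω, IsLUB ((fun f : EuclideanSpace ℝ (Fin n) → ℝ => f ω) '' S) (p ω))
    (hlin : ∀ ℓ : EuclideanSpace ℝ (Fin n) →L[ℝ] ℝ, ∃ C : ℝ, 0 < C ∧
      ∀ ω ∈ Ω, |ℓ ω| ≤ C * (p ω + 1))
    (μ ν : Measure (EuclideanSpace ℝ (Fin n)))
    [IsProbabilityMeasure μ] [IsProbabilityMeasure ν]
    (hμΩ : μ Ωᶜ = 0) (hνΩ : ν Ωᶜ = 0)
    (hμreg : μ.InnerRegular) (hνreg : ν.InnerRegular)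
    (hpμ : Integrable p μ) (hpν : Integrable p ν)
    (horder : ∀ (k : ℕ) (a : Fin (k + 1) → EuclideanSpace ℝ (Fin n) → ℝ),
      (∀ i, IsHarmonicOn Ω (a i)) →
      (∀ i, ∃ C : ℝ, 0 < C ∧ ∀ ω ∈ Ω, |a i ω| ≤ C * (p ω + 1)) →
      ∫ ω, Finset.univ.sup' Finset.univ_nonempty (fun i => a i ω) ∂μ ≤
        ∫ ω, Finset.univ.sup' Finset.univ_nonempty (fun i => a i ω) ∂ν) :
    ∃ π : Measure (EuclideanSpace ℝ (Fin n) × EuclideanSpace ℝ (Fin n)),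
      IsProbabilityMeasure π ∧ π.InnerRegular ∧
      π.map Prod.fst = μ ∧ π.map Prod.snd = ν ∧
      ∀ (k : ℕ) (a : Fin (k + 1) → EuclideanSpace ℝ (Fin n) → ℝ),
        (∀ i, IsHarmonicOn Ω (a i)) →
        (∀ i, ∃ C : ℝ, 0 < C ∧ ∀ ω ∈ Ω, |a i ω| ≤ C * (p ω + 1)) →
        ∀ h : EuclideanSpace ℝ (Fin n) → ℝ, Measurable h → (∀ ω, 0 ≤ h ω) →
          (∃ M : ℝ, ∀ ω, h ω ≤ M) →
          ∫ ω, h ω * Finset.univ.sup' Finset.univ_nonempty (fun i => a i ω) ∂μ ≤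
            ∫ x : EuclideanSpace ℝ (Fin n) × EuclideanSpace ℝ (Fin n),
              h x.1 * Finset.univ.sup' Finset.univ_nonempty (fun i => a i x.2) ∂π := by
  have hΩm : MeasurableSet Ω := hΩo.measurableSet
  have he : MeasurableEmbedding (Subtype.val : Ω → EuclideanSpace ℝ (Fin n)) :=
    MeasurableEmbedding.subtype_coe hΩm
  have : LocallyCompactSpace Ω := hΩo.locallyCompactSpace
  have hmap : ∀ ρ : Measure (EuclideanSpace ℝ (Fin n)), ρ Ωᶜ = 0 →
      (ρ.comap Subtype.val : Measure Ω).map Subtype.val = ρ := fun ρ hρ => by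
    rw [he.map_comap, Subtype.range_coe]
    exact Measure.restrict_eq_self_of_ae_mem (mem_ae_iff.2 hρ)
  have hprob : ∀ ρ : Measure (EuclideanSpace ℝ (Fin n)), IsProbabilityMeasure ρ → ρ Ωᶜ = 0 →
      IsProbabilityMeasure (ρ.comap Subtype.val : Measure Ω) := fun ρ hρ hρΩ =>
    ⟨by rw [← Set.preimage_univ (f := Subtype.val), ← he.map_apply, hmap ρ hρΩ, measure_univ]⟩
  have hint : ∀ ρ : Measure (EuclideanSpace ℝ (Fin n)), ρ Ωᶜ = 0 →
      ∀ f : EuclideanSpace ℝ (Fin n) → ℝ,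
        ∫ ω, f ω ∂ρ = ∫ x, f x.1 ∂(ρ.comap Subtype.val : Measure Ω) := fun ρ hρ f => by
    rw [← he.integral_map, hmap ρ hρ]
  have := hprob μ ‹_› hμΩ
  have := hprob ν ‹_› hνΩ
  let q : C(Ω, ℝ) := ⟨fun x => p x + 1, hpc.domRestrict.add continuous_const⟩
  have hq1 : ∀ x, 1 ≤ q x := fun x => le_add_of_nonneg_left (hp0 x x.2)
  have hqi : ∀ ρ : Measure (EuclideanSpace ℝ (Fin n)), IsProbabilityMeasure ρ → ρ Ωᶜ = 0 →
      Integrable p ρ → Integrable q (ρ.comap Subtype.val : Measure Ω) := fun ρ _ hρΩ hp => by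
    refine (he.integrable_map_iff (g := fun ω => p ω + 1)).1 ?_
    rw [hmap ρ hρΩ]
    exact hp.add (integrable_const 1)
  have hqc : ∀ c : ℝ, IsCompact {x | q x ≤ c} := fun c => by
    rw [Subtype.isCompact_iff]
    convert hproper (Set.Icc 0 (c - 1)) isCompact_Icc using 1
    ext ω
    constructor
    · rintro ⟨x, hx, rfl⟩
      exact ⟨x.2, hp0 x x.2, le_sub_iff_add_le.2 hx⟩
    · rintro ⟨hω, -, hω'⟩
      exact ⟨⟨ω, hω⟩, le_sub_iff_add_le.1 hω', rfl⟩
  obtain ⟨π, hπ, hπμ, hπν, hπA⟩ := exists_submartingale_coupling hq1 (hqi μ ‹_› hμΩ hpμ)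
    (hqi ν ‹_› hνΩ hpν) (A := harmonicGrowth Ω q) (fun a ha => ha.1)
    ⟨⟨1, fun x => by simpa using hq1 x⟩, _, isHarmonicOn_const 1, fun _ => rfl⟩
    (fun k a ha => by
      choose b hb hba using fun i => (ha i).2
      choose C hC0 hC using fun i => exists_pos_growth_bound hq1 ⟨a i, (ha i).1⟩
      have := horder k b hb fun i => ⟨C i, hC0 i, fun ω hω => by
        rw [hba i ⟨ω, hω⟩]
        exact hC i ⟨ω, hω⟩⟩
      rw [hint μ hμΩ, hint ν hνΩ] at this
      simpa only [hba] using this) hqc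
  have hg : Measurable (Prod.map Subtype.val Subtype.val :
      Ω × Ω → EuclideanSpace ℝ (Fin n) × EuclideanSpace ℝ (Fin n)) :=
    measurable_subtype_coe.prodMap measurable_subtype_coe
  have hge : MeasurableEmbedding (Prod.map Subtype.val Subtype.val :
      Ω × Ω → EuclideanSpace ℝ (Fin n) × EuclideanSpace ℝ (Fin n)) := he.prodMap he
  have hprobπ := Measure.isProbabilityMeasure_map (μ := π) hg.aemeasurable
  refine ⟨π.map (Prod.map Subtype.val Subtype.val), hprobπ, inferInstance, ?_, ?_,
    fun k a ha hC h hm h0 hM => ?_⟩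
  · rw [Measure.map_map measurable_fst hg]
    change π.map (Subtype.val ∘ Prod.fst) = μ
    rw [← Measure.map_map measurable_subtype_coe measurable_fst, hπμ, hmap μ hμΩ]
  · rw [Measure.map_map measurable_snd hg]
    change π.map (Subtype.val ∘ Prod.snd) = ν
    rw [← Measure.map_map measurable_subtype_coe measurable_snd, hπν, hmap ν hνΩ]
  · rw [hint μ hμΩ, hge.integral_map]
    exact hπA k (fun i => ⟨fun x => a i x, (ha i).1.domRestrict⟩)
      (fun i => ⟨(hC i).imp fun C hC x => hC.2 x x.2, a i, ha i, fun _ => rfl⟩)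
      (fun x => h x) (hm.comp measurable_subtype_coe) (fun x => h0 x)
      (hM.imp fun M hM x => hM x)
end

section
/- Let Ω ⊆ ℝⁿ be a nonempty open set. Then there exists a continuous, nonnegative function p : Ω → ℝ which is proper (the preimage of every compact subset of ℝ is a compact subset of Ω) and which is the pointwise supremum of a family of harmonic functions on Ω. Moreover, given any finitely many harmonic functions a₁,…,a_k on Ω, the function p can be chosen so that additionally aᵢ(ω) ≤ p(ω) for all ω ∈ Ω and all i = 1,…,k. -/
open MeasureTheory Metric

section MeanValue

open InnerProductSpace Laplacian Module

/-- The truncated paraboloid `max (ρ² - ‖x - c‖²) 0` is Lipschitz. -/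
theorem lipschitzWith_max_sq_sub_norm_sq {E : Type*} [NormedAddCommGroup E] (c : E)
    {ρ : ℝ} (hρ : 0 ≤ ρ) :
    LipschitzWith (Real.toNNReal (2 * ρ)) fun x : E ↦ max (ρ ^ 2 - ‖x - c‖ ^ 2) 0 := by
  refine LipschitzWith.of_le_add_mul' _ fun x y ↦ ?_
  have hd : ‖y - c‖ ≤ dist x y + ‖x - c‖ := by
    rw [← dist_eq_norm, ← dist_eq_norm, dist_comm x y]
    exact dist_triangle y x c
  have hd0 : 0 ≤ dist x y := dist_nonneg
  have hx := norm_nonneg (x - c)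
  have hy := norm_nonneg (y - c)
  refine max_le ?_ (by positivity)
  rcases le_total ρ ‖x - c‖ with h | h
  · have := le_max_right (ρ ^ 2 - ‖y - c‖ ^ 2) 0
    nlinarith [mul_nonneg hρ hd0]
  · rcases le_total ‖y - c‖ ρ with h' | h'
    · have := le_max_left (ρ ^ 2 - ‖y - c‖ ^ 2) 0
      rcases le_total ‖x - c‖ ‖y - c‖ with h'' | h''
      · nlinarith
      · nlinarith [mul_nonneg hρ hd0]
    · have := le_max_right (ρ ^ 2 - ‖y - c‖ ^ 2) 0
      nlinarith

variable {E : Type*} [NormedAddCommGroup E] [InnerProductSpace ℝ E] [FiniteDimensional ℝ E]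

theorem laplacian_eq_sum_fderiv_fderiv {ι : Type*} [Fintype ι] (b : OrthonormalBasis ι ℝ E)
    {f : E → ℝ} {x : E} (hf : ContDiffAt ℝ 2 f x) :
    Δ f x = ∑ i, fderiv ℝ (fun y ↦ fderiv ℝ f y (b i)) x (b i) := by
  rw [laplacian_eq_iteratedFDeriv_orthonormalBasis f b]
  refine Finset.sum_congr rfl fun i _ ↦ ?_
  have h1 : DifferentiableAt ℝ (fderiv ℝ f) x :=
    (hf.fderiv_right (m := 1) (by norm_num)).differentiableAt (by norm_num)
  rw [iteratedFDeriv_two_apply, fderiv_clm_apply h1 (by fun_prop)]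
  simp

variable [MeasurableSpace E] [BorelSpace E] (μ : Measure E) [μ.IsAddHaarMeasure]

theorem setIntegral_closedBall_eq (f : E → ℝ) (c : E) {r : ℝ} (hr : 0 < r) :
    ∫ x in closedBall c r, f x ∂μ =
      r ^ finrank ℝ E * ∫ x in closedBall 0 1, f (c + r • x) ∂μ := by
  rw [Measure.setIntegral_comp_smul_of_pos μ (fun x ↦ f (c + x)) _ hr,
    smul_closedBall r (0 : E) zero_le_one, smul_eq_mul, mul_inv_cancel_left₀ (by positivity),
    ← (measurePreserving_add_left μ c).setIntegral_preimage_emb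
      (measurableEmbedding_addLeft c) f]
  simp [abs_of_pos hr]

/-- If `u` is harmonic in a ball, then the flux of its gradient through concentric spheres
vanishes; here integrated over all the concentric spheres. -/
theorem setIntegral_closedBall_fderiv_sub_eq_zero {u : E → ℝ} (hu : ContDiff ℝ 2 u)
    (hc : HasCompactSupport u) (c : E) {ρ : ℝ} (hρ : 0 < ρ) (hΔ : ∀ x ∈ ball c ρ, Δ u x = 0) :
    ∫ x in closedBall c ρ, fderiv ℝ u x (x - c) ∂μ = 0 := by
  set b := stdOrthonormalBasis ℝ E
  set w : E → ℝ := fun x ↦ max (ρ ^ 2 - ‖x - c‖ ^ 2) 0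
  have hw_lip := lipschitzWith_max_sq_sub_norm_sq c hρ.le
  have hw_zero : ∀ x ∉ ball c ρ, w x = 0 := fun x hx ↦ by
    rw [mem_ball, dist_eq_norm, not_lt] at hx
    exact max_eq_right (by nlinarith)
  have hw_supp : HasCompactSupport w :=
    HasCompactSupport.intro (isCompact_closedBall c ρ) fun x hx ↦
      hw_zero x fun h ↦ hx (ball_subset_closedBall h)
  have hD : ∀ i, ContDiff ℝ 1 fun x ↦ fderiv ℝ u x (b i) := fun i ↦
    (hu.fderiv_right (m := 1) (by norm_num)).clm_apply contDiff_const
  have hDc : ∀ i, HasCompactSupport fun x ↦ fderiv ℝ u x (b i) := fun i ↦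
    hc.fderiv_apply ℝ (b i)
  have hparts : ∀ i, ∫ x, fderiv ℝ (fun y ↦ fderiv ℝ u y (b i)) x (b i) * w x ∂μ =
      ∫ x in closedBall c ρ, 2 * (inner ℝ (x - c) (b i) * fderiv ℝ u x (b i)) ∂μ := by
    intro i
    obtain ⟨C, hC⟩ := (hD i).lipschitzWith_of_hasCompactSupport (hDc i) (by norm_num)
    have := LipschitzWith.integral_lineDeriv_mul_eq (μ := μ) hC hw_lip hw_supp (b i)
    have hline : ∀ x, lineDeriv ℝ (fun y ↦ fderiv ℝ u y (b i)) x (b i) =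
        fderiv ℝ (fun y ↦ fderiv ℝ u y (b i)) x (b i) := fun x ↦
      ((hD i).differentiable (by norm_num) x).lineDeriv_eq_fderiv
    simp only [hline] at this
    rw [this, ← integral_indicator isClosed_closedBall.measurableSet]
    refine integral_congr_ae ?_
    have hs : ∀ᵐ x ∂μ, x ∉ sphere c ρ :=
      measure_eq_zero_iff_ae_notMem.1 (Measure.addHaar_sphere_of_ne_zero μ c hρ.ne')
    filter_upwards [hs] with x hx
    by_cases hxb : x ∈ closedBall c ρ
    · have hxb' : x ∈ ball c ρ := lt_of_le_of_ne hxb hx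
      have hev : w =ᶠ[nhds x] fun y ↦ ρ ^ 2 - ‖y - c‖ ^ 2 := by
        filter_upwards [isOpen_ball.mem_nhds hxb'] with y hy
        rw [mem_ball, dist_eq_norm] at hy
        exact max_eq_left (by nlinarith [norm_nonneg (y - c)])
      have hd : HasFDerivAt (fun y : E ↦ ρ ^ 2 - ‖y - c‖ ^ 2)
          (-(2 • (innerSL ℝ (x - c)).comp (ContinuousLinearMap.id ℝ E))) x :=
        (((hasFDerivAt_id x).sub_const c).norm_sq).const_sub _
      rw [Set.indicator_of_mem hxb, hev.lineDeriv_eq, hd.differentiableAt.lineDeriv_eq_fderiv,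
        hd.fderiv]
      simp [inner_sub_left]
      ring
    · have hev : w =ᶠ[nhds x] fun _ ↦ 0 := by
        filter_upwards [isClosed_closedBall.isOpen_compl.mem_nhds hxb] with y hy
        exact hw_zero y fun h ↦ hy (ball_subset_closedBall h)
      rw [Set.indicator_of_notMem hxb, hev.lineDeriv_eq]
      simp [lineDeriv]
  have hint1 : ∀ i, Integrable
      (fun x ↦ fderiv ℝ (fun y ↦ fderiv ℝ u y (b i)) x (b i) * w x) μ := fun i ↦ by
    refine Continuous.integrable_of_hasCompactSupport ?_ hw_supp.mul_left
    exact (((hD i).continuous_fderiv (by norm_num)).clm_apply continuous_const).mul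
      hw_lip.continuous
  have hint2 : ∀ i, IntegrableOn
      (fun x ↦ 2 * (inner ℝ (x - c) (b i) * fderiv ℝ u x (b i))) (closedBall c ρ) μ := fun i ↦ by
    refine ContinuousOn.integrableOn_compact (isCompact_closedBall c ρ) (Continuous.continuousOn ?_)
    have := (hD i).continuous
    fun_prop
  have hsum : ∑ i, ∫ x, fderiv ℝ (fun y ↦ fderiv ℝ u y (b i)) x (b i) * w x ∂μ = 0 := by
    rw [← integral_finsetSum _ fun i _ ↦ hint1 i]
    refine integral_eq_zero_of_ae (Filter.Eventually.of_forall fun x ↦ ?_)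
    simp only [← Finset.sum_mul, ← laplacian_eq_sum_fderiv_fderiv b hu.contDiffAt]
    by_cases hx : x ∈ ball c ρ
    · simp [hΔ x hx]
    · simp [hw_zero x hx]
  simp_rw [hparts] at hsum
  rw [← integral_finsetSum _ fun i _ ↦ hint2 i] at hsum
  simp_rw [← Finset.mul_sum] at hsum
  rw [integral_const_mul] at hsum
  refine (setIntegral_congr_fun isClosed_closedBall.measurableSet fun x _ ↦ ?_).trans
    ((mul_eq_zero.1 hsum).resolve_left two_ne_zero)
  conv_lhs => rw [← b.sum_repr' (x - c)]
  simp [real_inner_comm]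

/-- Mean value property for compactly supported functions which are harmonic in a ball. -/
theorem setAverage_closedBall_of_laplacian_eq_zero {u : E → ℝ} (hu : ContDiff ℝ 2 u)
    (hc : HasCompactSupport u) (c : E) {ρ : ℝ} (hρ : 0 < ρ) (hΔ : ∀ x ∈ ball c ρ, Δ u x = 0) :
    ⨍ x in closedBall c ρ, u x ∂μ = u c := by
  have hDu : Continuous (fderiv ℝ u) := hu.continuous_fderiv (by norm_num)
  obtain ⟨C, hC⟩ := (hc.fderiv ℝ).exists_bound_of_continuous hDu
  have hfin : IsFiniteMeasure (μ.restrict (closedBall (0 : E) 1)) :=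
    ⟨by simpa using measure_closedBall_lt_top⟩
  have hderiv : ∀ t : ℝ, HasDerivAt (fun s : ℝ ↦ ∫ x in closedBall 0 1, u (c + s • x) ∂μ)
      (∫ x in closedBall 0 1, fderiv ℝ u (c + t • x) x ∂μ) t := by
    intro t
    refine (hasDerivAt_integral_of_dominated_loc_of_deriv_le (bound := fun _ ↦ C)
      (F' := fun s x ↦ fderiv ℝ u (c + s • x) x) Filter.univ_mem
      (Filter.Eventually.of_forall fun s ↦ ?_) ?_ ?_ ?_ (integrable_const C) ?_).2
    · have := hu.continuous
      exact Continuous.aestronglyMeasurable (by fun_prop)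
    · have := hu.continuous
      exact ContinuousOn.integrableOn_compact (isCompact_closedBall 0 1)
        (Continuous.continuousOn (by fun_prop))
    · exact Continuous.aestronglyMeasurable (by fun_prop)
    · filter_upwards [ae_restrict_mem isClosed_closedBall.measurableSet] with x hx s _
      rw [mem_closedBall_zero_iff] at hx
      calc ‖fderiv ℝ u (c + s • x) x‖ ≤ ‖fderiv ℝ u (c + s • x)‖ * ‖x‖ :=
            ContinuousLinearMap.le_opNorm _ _
        _ ≤ ‖fderiv ℝ u (c + s • x)‖ * 1 := by gcongr
        _ ≤ C := by simpa using hC _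
    · refine Filter.Eventually.of_forall fun x s _ ↦ ?_
      have h1 : HasDerivAt (fun s : ℝ ↦ c + s • x) x s := by
        simpa using ((hasDerivAt_id s).smul_const x).const_add c
      exact ((hu.differentiable (by norm_num)) _).hasFDerivAt.comp_hasDerivAt s h1
  have hzero : ∀ t ∈ Set.Ico (0 : ℝ) ρ,
      HasDerivWithinAt (fun s : ℝ ↦ ∫ x in closedBall 0 1, u (c + s • x) ∂μ) 0 (Set.Ici t) t := by
    intro t ht
    suffices h : ∫ x in closedBall 0 1, fderiv ℝ u (c + t • x) x ∂μ = 0 from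
      h ▸ (hderiv t).hasDerivWithinAt
    rcases ht.1.eq_or_lt with rfl | h0
    · have := (Measure.measurePreserving_neg μ).setIntegral_preimage_emb
        (MeasurableEquiv.neg E).measurableEmbedding (fun x ↦ fderiv ℝ u c x) (closedBall 0 1)
      simp only [Set.neg_preimage, neg_closedBall, neg_zero, map_neg, integral_neg] at this
      simp only [zero_smul, add_zero]
      linarith
    · have := setIntegral_closedBall_fderiv_sub_eq_zero μ hu hc c h0
        fun x hx ↦ hΔ x (ball_subset_ball ht.2.le hx)
      rw [setIntegral_closedBall_eq μ _ c h0] at this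
      simp only [add_sub_cancel_left, map_smul, smul_eq_mul, integral_const_mul] at this
      simpa [h0.ne'] using this
  have hconst := constant_of_has_deriv_right_zero
    (fun t _ ↦ (hderiv t).continuousAt.continuousWithinAt) hzero ρ ⟨hρ.le, le_rfl⟩
  have hpos : 0 < μ.real (closedBall (0 : E) 1) :=
    ENNReal.toReal_pos (measure_closedBall_pos μ _ one_pos).ne' measure_closedBall_lt_top.ne
  rw [setAverage_eq, setIntegral_closedBall_eq μ _ c hρ, Measure.addHaar_real_closedBall' μ c hρ.le,
    hconst]
  simp only [zero_smul, add_zero, setIntegral_const, smul_eq_mul]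
  field_simp

/-- Mean value property of harmonic functions over closed balls. -/
theorem InnerProductSpace.HarmonicOnNhd.setAverage_closedBall {f : E → ℝ} {c : E} {r : ℝ}
    (hr : 0 < r) (hf : HarmonicOnNhd f (closedBall c r)) :
    ⨍ x in closedBall c r, f x ∂μ = f c := by
  obtain ⟨δ, hδ, hsub⟩ := (isCompact_closedBall c r).exists_cthickening_subset_open
    (isOpen_setOfPred_harmonicAt f) hf
  rw [cthickening_closedBall hδ.le hr.le] at hsub
  let χ : ContDiffBump c := ⟨r + δ / 3, r + δ / 2, by positivity, by linarith⟩
  have hone : ∀ x ∈ closedBall c r, (fun y ↦ χ y * f y) =ᶠ[nhds x] f := fun x hx ↦ by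
    have : x ∈ ball c χ.rIn := closedBall_subset_ball (by simp only [χ]; linarith) hx
    filter_upwards [χ.eventuallyEq_one_of_mem_ball this] with y hy
    simp [hy]
  have hsmooth : ContDiff ℝ 2 fun y ↦ χ y * f y := by
    refine contDiff_iff_contDiffAt.2 fun x ↦ ?_
    by_cases hx : x ∈ closedBall c (δ + r)
    · exact χ.contDiffAt.mul (hsub hx).1
    · refine contDiffAt_const (c := (0 : ℝ)).congr_of_eventuallyEq ?_
      filter_upwards [isClosed_closedBall.isOpen_compl.mem_nhds hx] with y hy
      rw [χ.zero_of_le_dist, zero_mul]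
      simp only [Set.mem_compl_iff, mem_closedBall, not_le] at hy
      simp only [χ]
      linarith
  have := setAverage_closedBall_of_laplacian_eq_zero μ hsmooth χ.hasCompactSupport.mul_right c
    hr fun x hx ↦ by
      rw [(laplacian_congr_nhds (hone x (ball_subset_closedBall hx))).eq_of_nhds]
      exact (hf x (ball_subset_closedBall hx)).2.eq_of_nhds
  rw [setAverage_congr_fun isClosed_closedBall.measurableSet
    (Filter.Eventually.of_forall fun x hx ↦ (hone x hx).eq_of_nhds)] at this
  rw [this, (hone c (mem_closedBall_self hr.le)).eq_of_nhds]

end MeanValue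

section Radial

open InnerProductSpace Laplacian Module Set Filter Topology

theorem isGreatest_inner_norm_le_one {E : Type*} [NormedAddCommGroup E]
    [InnerProductSpace ℝ E] (x : E) :
    IsGreatest ((fun v : E ↦ inner ℝ v x) '' {v | ‖v‖ ≤ 1}) ‖x‖ := by
  refine ⟨⟨‖x‖⁻¹ • x, ?_, ?_⟩, ?_⟩
  · simpa [norm_smul] using inv_mul_le_one
  · rcases eq_or_ne x 0 with rfl | hx
    · simp
    · have := norm_pos_iff.2 hx
      simp only [real_inner_smul_left, real_inner_self_eq_norm_sq]
      field_simp
  · rintro _ ⟨v, hv, rfl⟩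
    calc inner ℝ v x ≤ ‖v‖ * ‖x‖ := real_inner_le_norm v x
      _ ≤ ‖x‖ := mul_le_of_le_one_left (norm_nonneg x) hv

variable {E : Type*} [NormedAddCommGroup E] [InnerProductSpace ℝ E] [FiniteDimensional ℝ E]

/-- A function of `‖x - y‖²` with derivative proportional to `s ^ (-dim E / 2)` is harmonic
away from `y`. -/
theorem harmonicAt_comp_norm_sub_sq (H : ℝ → ℝ) {c : ℝ} (hH : ∀ s, 0 < s → ContDiffAt ℝ 2 H s)
    (hH' : ∀ s, 0 < s → HasDerivAt H (c * s ^ (-(finrank ℝ E : ℝ) / 2)) s) {x y : E}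
    (hxy : x ≠ y) : HarmonicAt (fun z ↦ H (‖z - y‖ ^ 2)) x := by
  have hpos : ∀ z, z ≠ y → 0 < ‖z - y‖ ^ 2 := fun z hz ↦ by
    have := norm_pos_iff.2 (sub_ne_zero.2 hz)
    positivity
  have hsm : ∀ z, z ≠ y → ContDiffAt ℝ 2 (fun z ↦ H (‖z - y‖ ^ 2)) z := fun z hz ↦
    (hH _ (hpos z hz)).comp z ((contDiffAt_id.sub contDiffAt_const).norm_sq ℝ)
  refine ⟨hsm x hxy, ?_⟩
  filter_upwards [isOpen_ne.mem_nhds hxy] with x hxy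
  set b := stdOrthonormalBasis ℝ E
  set p : ℝ := -(finrank ℝ E : ℝ) / 2 with hp
  have hsq : ∀ z, HasFDerivAt (fun z : E ↦ ‖z - y‖ ^ 2)
      (2 • (innerSL ℝ (z - y)).comp (ContinuousLinearMap.id ℝ E)) z := fun z ↦
    ((hasFDerivAt_id z).sub_const y).norm_sq
  have hfd : ∀ z, z ≠ y → ∀ e, fderiv ℝ (fun z ↦ H (‖z - y‖ ^ 2)) z e =
      c * (‖z - y‖ ^ 2) ^ p * (2 * inner ℝ (z - y) e) := fun z hz e ↦ by
    have : HasFDerivAt (fun z ↦ H (‖z - y‖ ^ 2)) _ z :=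
      (hH' _ (hpos z hz)).comp_hasFDerivAt z (hsq z)
    rw [this.fderiv]
    simp [inner_sub_left]
  have hfd2 : ∀ i, fderiv ℝ (fun z ↦ fderiv ℝ (fun z ↦ H (‖z - y‖ ^ 2)) z (b i)) x (b i) =
      4 * c * p * (‖x - y‖ ^ 2) ^ (p - 1) * (inner ℝ (b i) (x - y)) ^ 2 +
        2 * c * (‖x - y‖ ^ 2) ^ p := fun i ↦ by
    have hev : (fun z ↦ fderiv ℝ (fun z ↦ H (‖z - y‖ ^ 2)) z (b i)) =ᶠ[𝓝 x]
        fun z ↦ c * (‖z - y‖ ^ 2) ^ p * (2 * inner ℝ (z - y) (b i)) := by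
      filter_upwards [isOpen_ne.mem_nhds hxy] with z hz using hfd z hz _
    have h1 := ((hsq x).rpow_const (p := p) (.inl (hpos x hxy).ne')).const_mul c
    have h2 : HasFDerivAt (fun z ↦ 2 * inner ℝ (z - y) (b i)) _ x :=
      (((hasFDerivAt_id x).sub_const y).inner ℝ (hasFDerivAt_const (b i) x)).const_mul 2
    have h3 : HasFDerivAt (fun z ↦ c * (‖z - y‖ ^ 2) ^ p * (2 * inner ℝ (z - y) (b i))) _ x :=
      h1.mul h2
    rw [hev.fderiv_eq, h3.fderiv]
    simp [inner_sub_left, real_inner_comm]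
    ring
  rw [laplacian_eq_sum_fderiv_fderiv b (hsm x hxy)]
  simp_rw [hfd2]
  rw [Finset.sum_add_distrib, ← Finset.mul_sum, b.sum_sq_inner_right, mul_assoc,
    ← Real.rpow_add_one (hpos x hxy).ne']
  simp [hp]
  ring

theorem harmonicAt_inner_left (v x : E) : HarmonicAt (fun z ↦ inner ℝ v z) x := by
  have hs : ∀ x, ContDiffAt ℝ 2 (fun z ↦ inner ℝ v z) x := fun x ↦
    contDiffAt_const.inner ℝ contDiffAt_id
  refine ⟨hs x, Eventually.of_forall fun x ↦ ?_⟩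
  rw [laplacian_eq_sum_fderiv_fderiv (stdOrthonormalBasis ℝ E) (hs x)]
  have : ∀ y, fderiv ℝ (fun z ↦ inner ℝ v z) y = innerSL ℝ v := fun y ↦ (innerSL ℝ v).fderiv
  simp [this]

variable (E) in
/-- There is a family of decreasing radial functions, harmonic away from their centre, whose
supremum is continuous and blows up at the centre. -/
theorem exists_radial_harmonic_family (hE : finrank ℝ E ≠ 0) :
    ∃ (G : Set (ℝ → ℝ)) (Ψ : ℝ → ℝ), (∀ g ∈ G, AntitoneOn g (Ioi 0)) ∧
      (∀ g ∈ G, ∀ x y : E, x ≠ y → HarmonicAt (fun z ↦ g (‖z - y‖ ^ 2)) x) ∧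
      ContinuousOn Ψ (Ioi 0) ∧ (∀ s, 0 < s → IsLUB ((fun g ↦ g s) '' G) (Ψ s)) ∧
      Tendsto Ψ (𝓝[>] 0) atTop := by
  obtain h | h | h : finrank ℝ E = 1 ∨ finrank ℝ E = 2 ∨ 2 < finrank ℝ E := by omega
  · refine ⟨(fun r s ↦ 2 / r - √s / r ^ 2) '' Ioi 0, fun s ↦ (√s)⁻¹, ?_, ?_, ?_, ?_, ?_⟩
    · rintro _ ⟨r, -, rfl⟩ s - t - hst
      have := Real.sqrt_le_sqrt hst
      dsimp only
      gcongr
    · rintro _ ⟨r, -, rfl⟩ x y hxy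
      refine harmonicAt_comp_norm_sub_sq (fun s ↦ 2 / r - √s / r ^ 2)
        (c := -(1 / (2 * r ^ 2))) (fun s hs ↦ ?_) (fun s hs ↦ ?_) hxy
      · exact contDiffAt_const.sub ((Real.contDiffAt_sqrt hs.ne').div_const _)
      · refine (((Real.hasDerivAt_sqrt hs.ne').div_const (r ^ 2)).const_sub (2 / r)).congr_deriv ?_
        rw [h, Nat.cast_one, neg_div, Real.rpow_neg hs.le, ← Real.sqrt_eq_rpow]
        field_simp
    · exact Real.continuous_sqrt.continuousOn.inv₀ fun s hs ↦ (Real.sqrt_pos.2 hs).ne'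
    · intro s hs
      have hs' := Real.sqrt_pos.2 hs
      refine IsGreatest.isLUB ⟨⟨_, ⟨√s, hs', rfl⟩, ?_⟩, ?_⟩
      · dsimp only
        field_simp
        norm_num
      · rintro _ ⟨_, ⟨r, hr, rfl⟩, rfl⟩
        have hr' : 0 < r := hr
        dsimp only
        rw [div_sub_div _ _ hr'.ne' (by positivity), inv_eq_one_div,
          div_le_div_iff₀ (by positivity) hs']
        nlinarith [mul_nonneg hr'.le (sq_nonneg (r - √s))]
    · refine tendsto_inv_nhdsGT_zero.comp (tendsto_nhdsWithin_iff.2 ⟨?_, ?_⟩)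
      · simpa using (Real.continuous_sqrt.tendsto 0).mono_left nhdsWithin_le_nhds
      · filter_upwards [self_mem_nhdsWithin] with s hs using Real.sqrt_pos.2 hs
  · refine ⟨{fun s ↦ -Real.log s}, fun s ↦ -Real.log s, ?_, ?_, ?_, ?_, ?_⟩
    · rintro _ rfl s hs t - hst
      exact neg_le_neg (Real.log_le_log hs hst)
    · rintro _ rfl x y hxy
      refine harmonicAt_comp_norm_sub_sq (fun s ↦ -Real.log s)
        (c := -1) (fun s hs ↦ ?_) (fun s hs ↦ ?_) hxy
      · exact (Real.contDiffAt_log.2 hs.ne').neg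
      · refine (Real.hasDerivAt_log hs.ne').neg.congr_deriv ?_
        rw [h, Nat.cast_ofNat, neg_div, div_self two_ne_zero, Real.rpow_neg_one, neg_one_mul]
    · exact (Real.continuousOn_log.mono fun s hs ↦ (ne_of_gt hs : s ≠ 0)).neg
    · intro s _
      simp
    · exact tendsto_neg_atBot_atTop.comp Real.tendsto_log_nhdsGT_zero
  · set p : ℝ := 1 - (finrank ℝ E : ℝ) / 2 with hp
    have hp0 : p < 0 := by
      have : (2 : ℝ) < finrank ℝ E := by exact_mod_cast h
      linarith
    refine ⟨{fun s ↦ s ^ p}, fun s ↦ s ^ p, ?_, ?_, ?_, ?_, ?_⟩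
    · rintro _ rfl s hs t - hst
      exact Real.rpow_le_rpow_of_nonpos hs hst hp0.le
    · rintro _ rfl x y hxy
      refine harmonicAt_comp_norm_sub_sq (fun s ↦ s ^ p)
        (c := p) (fun s hs ↦ ?_) (fun s hs ↦ ?_) hxy
      · exact Real.contDiffAt_rpow_const_of_ne hs.ne'
      · convert Real.hasDerivAt_rpow_const (p := p) (.inl hs.ne') using 3
        rw [hp]
        ring
    · exact fun s hs ↦ (Real.continuousAt_rpow_const s p (.inl (ne_of_gt hs))).continuousWithinAt
    · intro s _
      simp
    · exact tendsto_rpow_neg_nhdsGT_zero hp0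

end Radial

section Exhaustion

open InnerProductSpace Set Filter Topology

variable {n : ℕ}

theorem InnerProductSpace.HarmonicOnNhd.isHarmonicOn {Ω : Set (EuclideanSpace ℝ (Fin n))}
    {f : EuclideanSpace ℝ (Fin n) → ℝ} (hf : HarmonicOnNhd f Ω) : IsHarmonicOn Ω f :=
  ⟨hf.continuousOn, fun _ _ _ hr hsub ↦ ((hf.mono hsub).setAverage_closedBall volume hr).symm⟩

/-- `p` is a nonnegative continuous function on `Ω` with sublevel sets contained in compact subsets
of `Ω`, and a pointwise supremum of harmonic functions. -/
structure IsHarmonicExhaustion (Ω : Set (EuclideanSpace ℝ (Fin n)))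
    (p : EuclideanSpace ℝ (Fin n) → ℝ) : Prop where
  continuousOn : ContinuousOn p Ω
  nonneg : ∀ x ∈ Ω, 0 ≤ p x
  exists_isCompact : ∀ R : ℝ, ∃ C ⊆ Ω, IsCompact C ∧ ∀ x ∈ Ω, p x ≤ R → x ∈ C
  exists_isLUB : ∃ S : Set (EuclideanSpace ℝ (Fin n) → ℝ), (∀ f ∈ S, IsHarmonicOn Ω f) ∧
    ∀ x ∈ Ω, IsLUB ((fun f : EuclideanSpace ℝ (Fin n) → ℝ ↦ f x) '' S) (p x)

namespace IsHarmonicExhaustion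

variable {Ω : Set (EuclideanSpace ℝ (Fin n))} {p : EuclideanSpace ℝ (Fin n) → ℝ}

theorem sup (hp : IsHarmonicExhaustion Ω p) {q : EuclideanSpace ℝ (Fin n) → ℝ} (hq : ContinuousOn q Ω)
    {S : Set (EuclideanSpace ℝ (Fin n) → ℝ)} (hS : ∀ f ∈ S, IsHarmonicOn Ω f)
    (hlub : ∀ x ∈ Ω, IsLUB ((fun f : EuclideanSpace ℝ (Fin n) → ℝ ↦ f x) '' S) (q x)) :
    IsHarmonicExhaustion Ω fun x ↦ p x ⊔ q x where
  continuousOn := hp.continuousOn.sup hq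
  nonneg x hx := (hp.nonneg x hx).trans le_sup_left
  exists_isCompact R := by
    obtain ⟨C, hCΩ, hC, h⟩ := hp.exists_isCompact R
    exact ⟨C, hCΩ, hC, fun x hx hxR ↦ h x hx (le_sup_left.trans hxR)⟩
  exists_isLUB := by
    obtain ⟨T, hT, hTp⟩ := hp.exists_isLUB
    refine ⟨T ∪ S, fun f hf ↦ hf.elim (hT f) (hS f), fun x hx ↦ ?_⟩
    rw [image_union]
    exact (hTp x hx).union (hlub x hx)

theorem isCompact_inter_preimage (hp : IsHarmonicExhaustion Ω p) {K : Set ℝ} (hK : IsCompact K) :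
    IsCompact (Ω ∩ p ⁻¹' K) := by
  obtain ⟨R, hR⟩ := hK.bddAbove
  obtain ⟨C, hCΩ, hC, h⟩ := hp.exists_isCompact R
  have : Ω ∩ p ⁻¹' K = C ∩ p ⁻¹' K := by
    ext x
    exact ⟨fun hx ↦ ⟨h x hx.1 (hR hx.2), hx.2⟩, fun hx ↦ ⟨hCΩ hx.1, hx.2⟩⟩
  rw [this]
  exact hC.of_isClosed_subset
    ((hp.continuousOn.mono hCΩ).preimage_isClosed_of_isClosed hC.isClosed hK.isClosed)
    inter_subset_left

end IsHarmonicExhaustion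

theorem exists_isLUB_harmonic_norm (Ω : Set (EuclideanSpace ℝ (Fin n))) :
    ∃ S : Set (EuclideanSpace ℝ (Fin n) → ℝ), (∀ f ∈ S, IsHarmonicOn Ω f) ∧
      ∀ x ∈ Ω, IsLUB ((fun f : EuclideanSpace ℝ (Fin n) → ℝ ↦ f x) '' S) ‖x‖ := by
  refine ⟨(fun v x ↦ inner ℝ v x) '' {v | ‖v‖ ≤ 1}, ?_, fun x _ ↦ ?_⟩
  · rintro _ ⟨v, -, rfl⟩
    exact HarmonicOnNhd.isHarmonicOn fun x _ ↦ harmonicAt_inner_left v x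
  · rw [image_image]
    exact (isGreatest_inner_norm_le_one x).isLUB

theorem exists_isHarmonicExhaustion {Ω : Set (EuclideanSpace ℝ (Fin n))} (hΩ : IsOpen Ω) :
    ∃ p, IsHarmonicExhaustion Ω p := by
  obtain ⟨S, hS, hSlub⟩ := exists_isLUB_harmonic_norm Ω
  by_cases hΩu : Ω = univ
  · refine ⟨norm, continuous_norm.continuousOn, fun x _ ↦ norm_nonneg x,
      fun R ↦ ⟨closedBall 0 R, hΩu ▸ subset_univ _, isCompact_closedBall 0 R,
        fun x _ hx ↦ by simpa using hx⟩, S, hS, hSlub⟩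
  have hne : Ωᶜ.Nonempty := nonempty_compl.2 hΩu
  by_cases hn : n = 0
  · subst hn
    refine ⟨norm, continuous_norm.continuousOn, fun x _ ↦ norm_nonneg x,
      fun R ↦ ⟨Ω, subset_rfl, Ω.toFinite.isCompact, fun x hx _ ↦ hx⟩, S, hS, hSlub⟩
  obtain ⟨G, Ψ, hanti, hharm, hΨ, hΨlub, hΨtop⟩ :=
    exists_radial_harmonic_family (EuclideanSpace ℝ (Fin n)) (by simpa using hn)
  have hpos : ∀ x ∈ Ω, 0 < infDist x Ωᶜ := fun x hx ↦
    (hΩ.isClosed_compl.notMem_iff_infDist_pos hne).1 fun h ↦ h hx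
  have hcont : ContinuousOn (fun x ↦ Ψ (infDist x Ωᶜ ^ 2)) Ω :=
    hΨ.comp ((continuous_infDist_pt _).pow 2).continuousOn fun x hx ↦ pow_pos (hpos x hx) 2
  let T : Set (EuclideanSpace ℝ (Fin n) → ℝ) := image2 (fun g y x ↦ g (‖x - y‖ ^ 2)) G Ωᶜ
  have hT : ∀ f ∈ T, IsHarmonicOn Ω f := by
    rintro _ ⟨g, hg, y, hy, rfl⟩
    exact HarmonicOnNhd.isHarmonicOn fun x hx ↦ hharm g hg x y fun h ↦ hy (h ▸ hx)
  have hTlub : ∀ x ∈ Ω,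
      IsLUB ((fun f : EuclideanSpace ℝ (Fin n) → ℝ ↦ f x) '' T) (Ψ (infDist x Ωᶜ ^ 2)) := by
    intro x hx
    have hx2 := pow_pos (hpos x hx) 2
    refine ⟨?_, fun B hB ↦ (hΨlub _ hx2).2 ?_⟩
    · rintro _ ⟨_, ⟨g, hg, y, hy, rfl⟩, rfl⟩
      have hle : infDist x Ωᶜ ^ 2 ≤ ‖x - y‖ ^ 2 := by
        rw [← dist_eq_norm]
        exact pow_le_pow_left₀ infDist_nonneg (infDist_le_dist_of_mem hy) 2
      exact (hanti g hg hx2 (hx2.trans_le hle) hle).trans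
        ((hΨlub _ hx2).1 (mem_image_of_mem _ hg))
    · rintro _ ⟨g, hg, rfl⟩
      obtain ⟨y, hy, hxy⟩ := hΩ.isClosed_compl.exists_infDist_eq_dist hne x
      refine hB ⟨_, mem_image2_of_mem hg hy, ?_⟩
      simp [hxy, dist_eq_norm]
  refine ⟨fun x ↦ ‖x‖ ⊔ Ψ (infDist x Ωᶜ ^ 2), continuous_norm.continuousOn.sup hcont,
    fun x _ ↦ (norm_nonneg x).trans le_sup_left, fun R ↦ ?_, S ∪ T,
    fun f hf ↦ hf.elim (hS f) (hT f), fun x hx ↦ ?_⟩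
  · obtain ⟨ε, hε, hεR⟩ := mem_nhdsGT_iff_exists_Ioo_subset.1
      (hΨtop.eventually (eventually_gt_atTop R))
    have hε' : 0 < ε := hε
    refine ⟨closedBall 0 R ∩ {x | ε ≤ infDist x Ωᶜ ^ 2}, fun x hx ↦ ?_,
      (isCompact_closedBall 0 R).inter_right
        (isClosed_le continuous_const ((continuous_infDist_pt _).pow 2)), fun x hx hxR ↦ ?_⟩
    · by_contra hxΩ
      have := hx.2
      rw [mem_ofPred_eq, infDist_zero_of_mem hxΩ] at this
      linarith
    · refine ⟨by simpa using le_sup_left.trans hxR, ?_⟩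
      by_contra hlt
      exact (hεR ⟨pow_pos (hpos x hx) 2, not_le.1 hlt⟩).not_ge (le_sup_right.trans hxR)
  · rw [image_union]
    exact (hSlub x hx).union (hTlub x hx)

end Exhaustion

/-- every nonempty open `Ω ⊆ ℝⁿ` admits a continuous nonnegative proper function
which is a pointwise supremum of harmonic functions on `Ω`, and which can moreover be chosen
to dominate any finitely many prescribed harmonic functions. -/
theorem stmt_4 {n : ℕ} (Ω : Set (EuclideanSpace ℝ (Fin n)))
    (hΩo : IsOpen Ω) (hΩne : Ω.Nonempty)
    (k : ℕ) (a : Fin k → EuclideanSpace ℝ (Fin n) → ℝ)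
    (ha : ∀ i, IsHarmonicOn Ω (a i)) :
    ∃ p : EuclideanSpace ℝ (Fin n) → ℝ,
      ContinuousOn p Ω ∧ (∀ ω ∈ Ω, 0 ≤ p ω) ∧
      (∀ K : Set ℝ, IsCompact K → IsCompact (Ω ∩ p ⁻¹' K)) ∧
      (∃ S : Set (EuclideanSpace ℝ (Fin n) → ℝ), (∀ f ∈ S, IsHarmonicOn Ω f) ∧
        ∀ ω ∈ Ω, IsLUB ((fun f : EuclideanSpace ℝ (Fin n) → ℝ => f ω) '' S) (p ω)) ∧
      ∀ i, ∀ ω ∈ Ω, a i ω ≤ p ω := by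
  suffices h : ∀ s : Finset (Fin k), ∃ p, IsHarmonicExhaustion Ω p ∧
      ∀ i ∈ s, ∀ ω ∈ Ω, a i ω ≤ p ω by
    obtain ⟨p, hp, hap⟩ := h Finset.univ
    exact ⟨p, hp.continuousOn, hp.nonneg, fun K hK ↦ hp.isCompact_inter_preimage hK,
      hp.exists_isLUB, fun i ↦ hap i (Finset.mem_univ i)⟩
  intro s
  induction s using Finset.induction_on with
  | empty =>
    obtain ⟨p, hp⟩ := exists_isHarmonicExhaustion hΩo
    exact ⟨p, hp, by simp⟩
  | insert i s _ ih =>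
    obtain ⟨p, hp, hap⟩ := ih
    refine ⟨fun x ↦ p x ⊔ a i x, hp.sup (ha i).1 (S := {a i}) (fun f hf ↦ hf ▸ ha i)
      fun x _ ↦ by simp, fun j hj ω hω ↦ ?_⟩
    rcases Finset.mem_insert.1 hj with rfl | hj
    · exact le_sup_right
    · exact (hap j hj ω hω).trans le_sup_left
end

section
/- Let Ω be a σ-compact, locally compact Hausdorff topological space and let 𝒜 be a linear space of continuous real-valued functions on Ω that contains the constant functions and separates the points of Ω. Then the following conditions are equivalent: (1) for every compact set K ⊆ Ω and every C ≥ 1, the set {ω ∈ Ω : a(ω) ≤ C·sup_{K}|a| for all a ∈ 𝒜} is a compact subset of Ω; (2) there exists a nonnegative, continuous, proper function p on Ω such that p is the pointwise supremum of a symmetric family of functions in 𝒜; (3) there exists a nonnegative, proper function p on Ω, bounded on compact sets, such that p is the pointwise supremum of a symmetric family of functions in 𝒜. -/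
open Set

/-- If `K` and `T` are compact and `T` avoids the `C`-hull of `K`, then there is a finite symmetric
family in `A`, bounded by `1` on `K`, some member of which exceeds `C - 1` at each point
of `T`. -/
theorem exists_finite_symmetric_family {Ω : Type*} [TopologicalSpace Ω]
    (A : Submodule ℝ (Ω → ℝ)) (hcont : ∀ a ∈ A, Continuous a) (hone : (1 : Ω → ℝ) ∈ A)
    {K T : Set Ω} (hK : IsCompact K) (hT : IsCompact T) {C : ℝ} (hC : 1 ≤ C)
    (hKT : ∀ ω ∈ T, ∃ a ∈ A, C * sSup ((fun x => |a x|) '' K) < a ω) :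
    ∃ F : Set (Ω → ℝ), F.Finite ∧ F ⊆ (A : Set (Ω → ℝ)) ∧ (∀ f ∈ F, -f ∈ F) ∧ 1 ∈ F ∧
      (∀ f ∈ F, ∀ ω ∈ K, |f ω| ≤ 1) ∧ ∀ ω ∈ T, ∃ f ∈ F, C - 1 < f ω := by
  have hC0 : 0 < C := by linarith
  have key : ∀ ω ∈ T, ∃ f ∈ A, (∀ x ∈ K, |f x| ≤ 1) ∧ C - 1 < f ω := by
    intro ω hω
    obtain ⟨a, haA, ha⟩ := hKT ω hω
    set s := sSup ((fun x => |a x|) '' K)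
    have hs0 : 0 ≤ s := Real.sSup_nonneg (by rintro _ ⟨x, -, rfl⟩; exact abs_nonneg _)
    have haω : 0 < a ω := lt_of_le_of_lt (by positivity) ha
    refine ⟨(C / a ω) • a, A.smul_mem _ haA, fun x hx => ?_, ?_⟩
    · have hle : |a x| ≤ s :=
        le_csSup (hK.bddAbove_image (hcont a haA).abs.continuousOn) ⟨x, hx, rfl⟩
      rw [Pi.smul_apply, smul_eq_mul, abs_mul, abs_of_pos (by positivity), div_mul_eq_mul_div,
        div_le_one haω]
      exact (mul_le_mul_of_nonneg_left hle hC0.le).trans ha.le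
    · rw [Pi.smul_apply, smul_eq_mul, div_mul_cancel₀ _ haω.ne']
      linarith
  choose! f hfA hfK hfT using key
  obtain ⟨t, htT, hcover⟩ := hT.elim_nhds_subcover (fun ω => {x | C - 1 < f ω x})
    fun ω hω => (isOpen_lt continuous_const (hcont _ (hfA ω hω))).mem_nhds (hfT ω hω)
  set G : Set (Ω → ℝ) := insert 1 (f '' t)
  have hGfin : G.Finite := (t.finite_toSet.image f).insert 1
  have hGA : ∀ g ∈ G, g ∈ A := by
    rintro g (rfl | ⟨ω, hω, rfl⟩)
    exacts [hone, hfA ω (htT ω hω)]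
  have hGK : ∀ g ∈ G, ∀ x ∈ K, |g x| ≤ 1 := by
    rintro g (rfl | ⟨ω, hω, rfl⟩) x hx
    exacts [by simp, hfK ω (htT ω hω) x hx]
  refine ⟨G ∪ Neg.neg '' G, hGfin.union (hGfin.image _), ?_, ?_, .inl (.inl rfl), ?_, ?_⟩
  · rintro g (hg | ⟨g, hg, rfl⟩)
    exacts [hGA g hg, A.neg_mem (hGA g hg)]
  · rintro g (hg | ⟨g, hg, rfl⟩)
    · exact .inr ⟨g, hg, rfl⟩
    · exact .inl (by simpa using hg)
  · rintro g (hg | ⟨g, hg, rfl⟩) x hx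
    · exact hGK g hg x hx
    · simpa using hGK g hg x hx
  · intro ω hω
    obtain ⟨x, hx, hxω⟩ := mem_iUnion₂.1 (hcover hω)
    exact ⟨f x, .inl (.inr ⟨x, hx, rfl⟩), hxω⟩

/-- If `C`-hulls of compact sets are compact, there is a continuous nonnegative proper function
which is the pointwise supremum of a symmetric family in `A`. -/
theorem exists_continuous_proper_of_isCompact_hull {Ω : Type*} [TopologicalSpace Ω]
    [SigmaCompactSpace Ω] [WeaklyLocallyCompactSpace Ω] [T2Space Ω]
    (A : Submodule ℝ (Ω → ℝ)) (hcont : ∀ a ∈ A, Continuous a) (hone : (1 : Ω → ℝ) ∈ A)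
    (hull : ∀ K : Set Ω, IsCompact K → ∀ C : ℝ, 1 ≤ C →
        IsCompact {ω : Ω | ∀ a ∈ A, a ω ≤ C * sSup ((fun x => |a x|) '' K)}) :
    ∃ p : Ω → ℝ, Continuous p ∧ (∀ ω, 0 ≤ p ω) ∧
        (∀ K : Set ℝ, IsCompact K → IsCompact (p ⁻¹' K)) ∧
        ∃ S : Set (Ω → ℝ), S ⊆ (A : Set (Ω → ℝ)) ∧ (∀ f ∈ S, -f ∈ S) ∧
          ∀ ω, IsLUB ((fun f : Ω → ℝ => f ω) '' S) (p ω) := by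
  let E : CompactExhaustion Ω := default
  have hφ : ∀ n : ℕ, ∃ m : ℕ, n ≤ m ∧
      {ω : Ω | ∀ a ∈ A, a ω ≤ ((n : ℝ) + 1) * sSup ((fun x => |a x|) '' E n)} ⊆
        interior (E m) := by
    intro n
    obtain ⟨m, hm⟩ := E.exists_superset_of_isCompact
      (hull (E n) (E.isCompact n) ((n : ℝ) + 1) (by simp))
    refine ⟨max n m + 1, by omega, hm.trans ((E.subset (le_max_right n m)).trans ?_)⟩
    exact E.subset_interior_succ _
  choose φ hnφ hhull using hφ
  have hF : ∀ n : ℕ, ∃ F : Set (Ω → ℝ), F.Finite ∧ F ⊆ (A : Set (Ω → ℝ)) ∧ (∀ f ∈ F, -f ∈ F) ∧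
      1 ∈ F ∧ (∀ f ∈ F, ∀ ω ∈ E n, |f ω| ≤ 1) ∧
      ∀ ω ∈ E (φ (n + 1)) \ interior (E (φ n)), ∃ f ∈ F, (n : ℝ) + 1 - 1 < f ω := by
    refine fun n => exists_finite_symmetric_family A hcont hone (E.isCompact n)
      ((E.isCompact _).diff isOpen_interior) (by simp) fun ω hω => ?_
    by_contra! h
    exact hω.2 (hhull n h)
  choose F hFfin hFA hFneg hFone hFle hFlt using hF
  set S : Set (Ω → ℝ) := ⋃ n, F n
  have hGfin : ∀ m : ℕ, (⋃ n ∈ Iic m, F n).Finite := fun m =>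
    (finite_Iic m).biUnion fun n _ => hFfin n
  let G : ℕ → Finset (Ω → ℝ) := fun m => (hGfin m).toFinset
  have memG : ∀ m f, f ∈ G m ↔ ∃ n ≤ m, f ∈ F n := by
    intro m f
    simp [G]
  have oneG : ∀ m, 1 ∈ G m := fun m => (memG m 1).2 ⟨m, le_rfl, hFone m⟩
  let g : ℕ → Ω → ℝ := fun m ω => (G m).sup' ⟨1, oneG m⟩ fun f => f ω
  have hgcont : ∀ m, Continuous (g m) := by
    refine fun m => Continuous.finset_sup'_apply _ fun f hf => ?_
    obtain ⟨n, -, hn⟩ := (memG m f).1 hf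
    exact hcont f (hFA n hn)
  have hgLUB : ∀ m, ∀ ω ∈ E m, IsLUB ((fun f : Ω → ℝ => f ω) '' S) (g m ω) := by
    refine fun m ω hω => ⟨?_, fun b hb => Finset.sup'_le _ _ fun f hf => ?_⟩
    · rintro _ ⟨f, hf, rfl⟩
      obtain ⟨n, hn⟩ := mem_iUnion.1 hf
      rcases le_total n m with hnm | hmn
      · exact Finset.le_sup' (fun f : Ω → ℝ => f ω) ((memG m f).2 ⟨n, hnm, hn⟩)
      · exact ((le_abs_self _).trans (hFle n f hn ω (E.subset hmn hω))).trans
          (Finset.le_sup' (fun f : Ω → ℝ => f ω) (oneG m))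
    · obtain ⟨n, -, hn⟩ := (memG m f).1 hf
      exact hb ⟨f, mem_iUnion.2 ⟨n, hn⟩, rfl⟩
  set p : Ω → ℝ := fun ω => sSup ((fun f : Ω → ℝ => f ω) '' S)
  have hpg : ∀ m, ∀ ω ∈ E m, p ω = g m ω := fun m ω hω =>
    (hgLUB m ω hω).csSup_eq ⟨_, 1, mem_iUnion.2 ⟨0, hFone 0⟩, rfl⟩
  have hpLUB : ∀ ω, IsLUB ((fun f : Ω → ℝ => f ω) '' S) (p ω) := by
    intro ω
    obtain ⟨m, hm⟩ := E.exists_mem ω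
    rw [hpg m ω hm]
    exact hgLUB m ω hm
  have hpcont : Continuous p := by
    refine continuous_iff_continuousAt.2 fun ω => ?_
    obtain ⟨m, hm⟩ := E.exists_mem ω
    refine (hgcont (m + 1)).continuousAt.congr ?_
    filter_upwards [isOpen_interior.mem_nhds (E.subset_interior_succ m hm)] with x hx
    exact (hpg (m + 1) x (interior_subset hx)).symm
  have hpgt : ∀ N : ℕ, ∀ ω ∉ E (φ N), (N : ℝ) < p ω := by
    intro N ω hω
    obtain ⟨m, hm⟩ := E.exists_mem ω
    have hex : ∃ k, ω ∈ E (φ (N + k)) :=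
      ⟨m, E.subset ((Nat.le_add_left m N).trans (hnφ _)) hm⟩
    obtain ⟨k, hk, hmin⟩ : ∃ k, ω ∈ E (φ (N + k + 1)) ∧ ω ∉ E (φ (N + k)) := by
      by_contra! h
      obtain ⟨k, hk⟩ := hex
      induction k with
      | zero => exact hω hk
      | succ k ih => exact ih (h k hk)
    obtain ⟨f, hf, hlt⟩ := hFlt (N + k) ω ⟨hk, fun h => hmin (interior_subset h)⟩
    have hle : f ω ≤ p ω := (hpLUB ω).1 ⟨f, mem_iUnion.2 ⟨_, hf⟩, rfl⟩
    push_cast at hlt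
    have hk0 : (0 : ℝ) ≤ k := k.cast_nonneg
    linarith
  refine ⟨p, hpcont, fun ω => ?_, fun K hK => ?_, S, iUnion_subset hFA, fun f hf => ?_, hpLUB⟩
  · exact zero_le_one.trans ((hpLUB ω).1 ⟨1, mem_iUnion.2 ⟨0, hFone 0⟩, rfl⟩)
  · obtain ⟨b, hb⟩ := hK.bddAbove
    obtain ⟨N, hN⟩ := exists_nat_ge b
    refine (E.isCompact (φ N)).of_isClosed_subset (hK.isClosed.preimage hpcont) fun ω hω => ?_
    by_contra h
    exact absurd (hpgt N ω h) (not_lt.2 ((hb hω).trans hN))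
  · obtain ⟨n, hn⟩ := mem_iUnion.1 hf
    exact mem_iUnion.2 ⟨n, hFneg n f hn⟩

/-- If some proper function, bounded on compact sets, is the pointwise supremum of a symmetric
family in `A`, then `C`-hulls of compact sets are compact. -/
theorem isCompact_hull_of_proper {Ω : Type*} [TopologicalSpace Ω]
    {A : Set (Ω → ℝ)} (hcont : ∀ a ∈ A, Continuous a) {p : Ω → ℝ} (hp0 : ∀ ω, 0 ≤ p ω)
    (hproper : ∀ K : Set ℝ, IsCompact K → IsCompact (p ⁻¹' K))
    {S : Set (Ω → ℝ)} (hSA : S ⊆ A) (hneg : ∀ f ∈ S, -f ∈ S)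
    (hLUB : ∀ ω, IsLUB ((fun f : Ω → ℝ => f ω) '' S) (p ω))
    {K : Set Ω} (hbdd : ∃ M : ℝ, ∀ ω ∈ K, p ω ≤ M) {C : ℝ} (hC : 0 ≤ C) :
    IsCompact {ω : Ω | ∀ a ∈ A, a ω ≤ C * sSup ((fun x => |a x|) '' K)} := by
  obtain ⟨M, hM⟩ := hbdd
  refine (hproper (Icc 0 (C * max M 0)) isCompact_Icc).of_isClosed_subset ?_ fun ω hω => ?_
  · simp only [ofPred_forall]
    exact isClosed_biInter fun a ha => isClosed_le (hcont a ha) continuous_const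
  · refine ⟨hp0 ω, (hLUB ω).2 ?_⟩
    rintro _ ⟨f, hf, rfl⟩
    refine (hω f (hSA hf)).trans (mul_le_mul_of_nonneg_left ?_ hC)
    refine Real.sSup_le ?_ (le_max_right _ _)
    rintro _ ⟨x, hx, rfl⟩
    refine (abs_le'.2 ⟨?_, ?_⟩).trans ((hM x hx).trans (le_max_left _ _))
    · exact (hLUB x).1 ⟨f, hf, rfl⟩
    · exact (hLUB x).1 ⟨-f, hneg f hf, rfl⟩

/-- For a σ-compact, locally compact Hausdorff space `Ω` and a linear space `𝒜`
of continuous functions containing the constants and separating points, the following are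
equivalent: (1) the `C`-hulls of compact sets are compact; (2) there is a nonnegative,
continuous, proper function which is a pointwise supremum of a symmetric family in `𝒜`;
(3) there is a nonnegative, proper function, bounded on compact sets, which is a pointwise
supremum of a symmetric family in `𝒜`. -/
theorem stmt_5 {Ω : Type*} [TopologicalSpace Ω] [SigmaCompactSpace Ω]
    [LocallyCompactSpace Ω] [T2Space Ω]
    (A : Submodule ℝ (Ω → ℝ))
    (hcont : ∀ a ∈ A, Continuous a)
    (hconst : ∀ c : ℝ, (fun _ : Ω => c) ∈ A)
    (hsep : ∀ x y : Ω, x ≠ y → ∃ a ∈ A, a x ≠ a y) :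
    List.TFAE
      [∀ K : Set Ω, IsCompact K → ∀ C : ℝ, 1 ≤ C →
        IsCompact {ω : Ω | ∀ a ∈ A, a ω ≤ C * sSup ((fun x => |a x|) '' K)},
      ∃ p : Ω → ℝ, Continuous p ∧ (∀ ω, 0 ≤ p ω) ∧
        (∀ K : Set ℝ, IsCompact K → IsCompact (p ⁻¹' K)) ∧
        ∃ S : Set (Ω → ℝ), S ⊆ (A : Set (Ω → ℝ)) ∧ (∀ f ∈ S, -f ∈ S) ∧
          ∀ ω, IsLUB ((fun f : Ω → ℝ => f ω) '' S) (p ω),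
      ∃ p : Ω → ℝ, (∀ ω, 0 ≤ p ω) ∧
        (∀ K : Set ℝ, IsCompact K → IsCompact (p ⁻¹' K)) ∧
        (∀ K : Set Ω, IsCompact K → ∃ M : ℝ, ∀ ω ∈ K, p ω ≤ M) ∧
        ∃ S : Set (Ω → ℝ), S ⊆ (A : Set (Ω → ℝ)) ∧ (∀ f ∈ S, -f ∈ S) ∧
          ∀ ω, IsLUB ((fun f : Ω → ℝ => f ω) '' S) (p ω)] := by
  tfae_have 1 → 2 := exists_continuous_proper_of_isCompact_hull A hcont (hconst 1)
  tfae_have 2 → 3 := by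
    rintro ⟨p, hp, hp0, hproper, hS⟩
    refine ⟨p, hp0, hproper, fun K hK => ?_, hS⟩
    obtain ⟨M, hM⟩ := hK.bddAbove_image hp.continuousOn
    exact ⟨M, fun ω hω => hM ⟨ω, hω, rfl⟩⟩
  tfae_have 3 → 1 := by
    rintro ⟨p, hp0, hproper, hbdd, S, hSA, hneg, hLUB⟩ K hK C hC
    exact isCompact_hull_of_proper hcont hp0 hproper hSA hneg hLUB (hbdd K hK)
      (zero_le_one.trans hC)
  tfae_finish
end

section
/- Let Ω be a set, let 𝒜 be a linear space of real-valued functions on Ω, and let 𝓕 be the smallest convex cone of functions from Ω to (−∞,∞] that contains 𝒜 and is stable under pointwise suprema of arbitrary nonempty families (the complete lattice cone generated by 𝒜). Then for every subset S ⊆ Ω, {ω ∈ Ω : f(ω) ≤ sup f(S) for all f ∈ 𝓕} = {ω ∈ Ω : a(ω) ≤ sup a(S) for all a ∈ 𝒜}, where suprema over S are taken in (−∞,∞]. -/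
/-- A convex cone of `(−∞,∞]`-valued functions stable under pointwise suprema of nonempty
families. -/
def IsSupCone {Ω : Type*} (K : Set (Ω → EReal)) : Prop :=
  (∀ f ∈ K, ∀ g ∈ K, ∀ α β : ℝ, 0 ≤ α → 0 ≤ β →
      (fun ω => (α : EReal) * f ω + (β : EReal) * g ω) ∈ K) ∧
  ∀ S : Set (Ω → EReal), S ⊆ K → S.Nonempty → (fun ω => ⨆ f ∈ S, f ω) ∈ K

/-- The complete lattice cone generated by a set `A` of real-valued functions: the smallest
convex cone of `(−∞,∞]`-valued functions containing (the coercions of members of) `A` and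
stable under pointwise suprema of nonempty families. -/
def completeLatticeConeGen {Ω : Type*} (A : Set (Ω → ℝ)) : Set (Ω → EReal) :=
  {f | ∀ K : Set (Ω → EReal), IsSupCone K →
    (∀ a ∈ A, (fun ω => (a ω : EReal)) ∈ K) → f ∈ K}

/-- The functions that are pointwise suprema of the members of `A` lying below them. -/
def minorantEnvelope {Ω : Type*} (A : Set (Ω → ℝ)) : Set (Ω → EReal) :=
  {f | (∃ a ∈ A, ∀ w, (a w : EReal) ≤ f w) ∧
    ∀ ω, ∀ r < f ω, ∃ a ∈ A, (∀ w, (a w : EReal) ≤ f w) ∧ r < a ω}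

theorem exists_minorant_lt_mul {Ω : Type*} {A : Set (Ω → ℝ)} {f : Ω → EReal}
    (hf : f ∈ minorantEnvelope A) {α : ℝ} (hα : 0 ≤ α) {ω : Ω} {r : EReal}
    (hr : r < (α : EReal) * f ω) :
    ∃ a ∈ A, (∀ w, (a w : EReal) ≤ f w) ∧ r < (α : EReal) * (a ω : EReal) := by
  rcases hα.eq_or_lt with rfl | hpos
  · obtain ⟨a, ha, hle⟩ := hf.1
    exact ⟨a, ha, hle, by simpa using hr⟩
  · have hpos' : (0 : EReal) < α := by exact_mod_cast hpos
    have htop : (α : EReal) ≠ ⊤ := EReal.coe_ne_top α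
    rw [mul_comm, ← EReal.div_lt_iff hpos' htop] at hr
    obtain ⟨a, ha, hle, hlt⟩ := hf.2 ω _ hr
    refine ⟨a, ha, hle, ?_⟩
    rwa [mul_comm, ← EReal.div_lt_iff hpos' htop]

theorem isSupCone_minorantEnvelope {Ω : Type*} (A : Submodule ℝ (Ω → ℝ)) :
    IsSupCone (minorantEnvelope (A : Set (Ω → ℝ))) := by
  constructor
  · intro f hf g hg α β hα hβ
    have hcomb : ∀ a ∈ A, ∀ b ∈ A, α • a + β • b ∈ A := fun a ha b hb =>
      A.add_mem (A.smul_mem α ha) (A.smul_mem β hb)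
    have hcoe : ∀ (a b : Ω → ℝ) (w : Ω), (((α • a + β • b) w : ℝ) : EReal)
        = (α : EReal) * (a w : EReal) + (β : EReal) * (b w : EReal) := fun a b w => by
      simp
    have hle : ∀ a b : Ω → ℝ, (∀ w, (a w : EReal) ≤ f w) → (∀ w, (b w : EReal) ≤ g w) →
        ∀ w, (((α • a + β • b) w : ℝ) : EReal) ≤ (α : EReal) * f w + (β : EReal) * g w := by
      intro a b ha hb w
      rw [hcoe]
      exact add_le_add
        (mul_le_mul_of_nonneg_left (ha w) (by exact_mod_cast hα))
        (mul_le_mul_of_nonneg_left (hb w) (by exact_mod_cast hβ))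
    refine ⟨?_, fun ω r hr => ?_⟩
    · obtain ⟨a, ha, ha'⟩ := hf.1
      obtain ⟨b, hb, hb'⟩ := hg.1
      exact ⟨_, hcomb a ha b hb, hle a b ha' hb'⟩
    · by_contra! hcon
      refine hr.not_ge (EReal.add_le_of_forall_lt fun x hx y hy => ?_)
      obtain ⟨a, ha, ha', hxa⟩ := exists_minorant_lt_mul hf hα hx
      obtain ⟨b, hb, hb', hyb⟩ := exists_minorant_lt_mul hg hβ hy
      have := hcon _ (hcomb a ha b hb) (hle a b ha' hb')
      rw [hcoe] at this
      exact (add_le_add hxa.le hyb.le).trans this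
  · intro T hT hne
    have hle : ∀ f ∈ T, ∀ w, f w ≤ ⨆ f ∈ T, f w := fun f hf w =>
      le_iSup₂ (f := fun (f : Ω → EReal) (_ : f ∈ T) => f w) f hf
    refine ⟨?_, fun ω r hr => ?_⟩
    · obtain ⟨f, hf⟩ := hne
      obtain ⟨a, ha, ha'⟩ := (hT hf).1
      exact ⟨a, ha, fun w => (ha' w).trans (hle f hf w)⟩
    · simp only [lt_iSup_iff] at hr
      obtain ⟨f, hf, hrf⟩ := hr
      obtain ⟨a, ha, ha', hra⟩ := (hT hf).2 ω r hrf
      exact ⟨a, ha, fun w => (ha' w).trans (hle f hf w), hra⟩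

/-- For a linear space `A` of real-valued functions on `Ω`, with `𝓕` the complete
lattice cone generated by `A`, and any `S ⊆ Ω`, the `𝓕`-hull of `S` coincides with the
`A`-hull of `S`. -/
theorem stmt_6 {Ω : Type*} (A : Submodule ℝ (Ω → ℝ)) (S : Set Ω) :
    {ω : Ω | ∀ f ∈ completeLatticeConeGen (A : Set (Ω → ℝ)), f ω ≤ ⨆ s ∈ S, f s}
      = {ω : Ω | ∀ a ∈ A, (a ω : EReal) ≤ ⨆ s ∈ S, (a s : EReal)} := by
  ext ω
  refine ⟨fun h a ha => h (fun w => (a w : EReal)) fun K _ hA => hA a ha, fun h f hf => ?_⟩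
  have hfE : f ∈ minorantEnvelope (A : Set (Ω → ℝ)) :=
    hf _ (isSupCone_minorantEnvelope A) fun a ha =>
      ⟨⟨a, ha, fun _ => le_rfl⟩, fun _ _ hr => ⟨a, ha, fun _ => le_rfl, hr⟩⟩
  refine le_of_forall_lt fun r hr => ?_
  obtain ⟨a, ha, hle, hra⟩ := hfE.2 ω r hr
  exact hra.trans_le ((h a ha).trans (iSup₂_mono fun s _ => hle s))
end

section
/- Let Ω be a Polish space, p : Ω → [0,∞) a Borel function, and 𝒢 a set of Borel functions g : Ω → ℝ with ‖g‖ := sup_ω |g(ω)|/(p(ω)+1) finite. Let μ and ν be Borel probability measures on Ω with ∫ p dμ < ∞ and ∫ p dν < ∞, and let δ > 0. Assume there exists a coupling π₀ of (μ, ν) such that for every g ∈ 𝒢 and every bounded nonnegative Borel measurable h one has ∫ h(ω₁) g(ω₁) dμ ≤ ∫ h(ω₁) g(ω₂) dπ₀. Then there exists a coupling π of (μ, ν) such that for every g ∈ 𝒢 and every bounded nonnegative Borel measurable h one has ∫ h(ω₁) g(ω₁) dμ − ∫ h(ω₁) g(ω₂) dπ ≤ δ·(sup h)·‖g‖, and whose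 topological support equals (supp μ) × (supp ν). -/
open MeasureTheory

/-- The weighted sup-norm `‖g‖ = sup_ω |g(ω)|/(p(ω)+1)`. -/
noncomputable def pNorm {Ω : Type*} (p : Ω → ℝ) (g : Ω → ℝ) : ℝ :=
  ⨆ ω : Ω, |g ω| / (p ω + 1)

/-- The topological support of a measure: the set of points all of whose open neighbourhoods
have positive measure (on a Polish space, the smallest closed set of full measure). -/
def measureSupport {Ω : Type*} [TopologicalSpace Ω] [MeasurableSpace Ω]
    (μ : Measure Ω) : Set Ω :=
  {x | ∀ U : Set Ω, IsOpen U → x ∈ U → μ U ≠ 0}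

/-- A function whose weighted sup-norm is finite is dominated by `pNorm p g * (p + 1)`. -/
theorem abs_le_pNorm_mul {Ω : Type*} {p g : Ω → ℝ} (hp : ∀ ω, 0 ≤ p ω)
    (hg : BddAbove (Set.range fun ω => |g ω| / (p ω + 1))) (ω : Ω) :
    |g ω| ≤ pNorm p g * (p ω + 1) := by
  have hpos : 0 < p ω + 1 := by linarith [hp ω]
  exact (div_le_iff₀ hpos).1 (le_ciSup hg ω)

theorem pNorm_nonneg {Ω : Type*} {p : Ω → ℝ} (hp : ∀ ω, 0 ≤ p ω) (g : Ω → ℝ) :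
    0 ≤ pNorm p g :=
  Real.iSup_nonneg fun ω => div_nonneg (abs_nonneg _) (by linarith [hp ω])

theorem norm_mul_comp_le_pNorm {X Ω : Type*} {φ : X → Ω} {p g : Ω → ℝ} {f : X → ℝ}
    {S : ℝ} (hp : ∀ ω, 0 ≤ p ω)
    (hg : BddAbove (Set.range fun ω => |g ω| / (p ω + 1))) (hfS : ∀ x, |f x| ≤ S) (x : X) :
    ‖f x * g (φ x)‖ ≤ S * pNorm p g * (p (φ x) + 1) := by
  rw [Real.norm_eq_abs, abs_mul, mul_assoc]
  exact mul_le_mul (hfS x) (abs_le_pNorm_mul hp hg _) (abs_nonneg _)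
    ((abs_nonneg _).trans (hfS x))

section WeightedIntegral

variable {X Ω : Type*} [MeasurableSpace X] [MeasurableSpace Ω] {ρ : Measure X}
  [IsProbabilityMeasure ρ] {φ : X → Ω} {p g : Ω → ℝ} {f : X → ℝ} {S : ℝ}

theorem integrable_mul_comp_of_bddAbove (hφ : Measurable φ) (hp : ∀ ω, 0 ≤ p ω)
    (hpi : Integrable p (ρ.map φ)) (hgm : Measurable g)
    (hg : BddAbove (Set.range fun ω => |g ω| / (p ω + 1)))
    (hf : Measurable f) (hfS : ∀ x, |f x| ≤ S) :
    Integrable (fun x => f x * g (φ x)) ρ :=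
  (((hpi.comp_measurable hφ).add (integrable_const 1)).const_mul (S * pNorm p g)).mono'
    (hf.mul (hgm.comp hφ)).aestronglyMeasurable
    (Filter.Eventually.of_forall (norm_mul_comp_le_pNorm hp hg hfS))

theorem abs_integral_mul_comp_le (hφ : Measurable φ) (hp : ∀ ω, 0 ≤ p ω)
    (hpi : Integrable p (ρ.map φ)) (hg : BddAbove (Set.range fun ω => |g ω| / (p ω + 1)))
    (hfS : ∀ x, |f x| ≤ S) :
    |∫ x, f x * g (φ x) ∂ρ| ≤ S * pNorm p g * (∫ ω, p ω ∂(ρ.map φ) + 1) := by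
  have hpφ : Integrable (fun x => p (φ x)) ρ := hpi.comp_measurable hφ
  calc |∫ x, f x * g (φ x) ∂ρ|
      ≤ ∫ x, S * pNorm p g * (p (φ x) + 1) ∂ρ :=
        norm_integral_le_of_norm_le ((hpφ.add (integrable_const 1)).const_mul _)
          (Filter.Eventually.of_forall (norm_mul_comp_le_pNorm hp hg hfS))
    _ = S * pNorm p g * (∫ ω, p ω ∂(ρ.map φ) + 1) := by
        rw [integral_const_mul, integral_add hpφ (integrable_const 1),
          integral_map hφ.aemeasurable hpi.aestronglyMeasurable]
        simp

end WeightedIntegral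

theorem measureSupport_subset_prod_map {X Y : Type*}
    [TopologicalSpace X] [MeasurableSpace X] [OpensMeasurableSpace X]
    [TopologicalSpace Y] [MeasurableSpace Y] [OpensMeasurableSpace Y]
    (π : Measure (X × Y)) :
    measureSupport π ⊆
      measureSupport (π.map Prod.fst) ×ˢ measureSupport (π.map Prod.snd) := by
  refine fun z hz => ⟨fun U hU hzU => ?_, fun U hU hzU => ?_⟩
  · rw [Measure.map_apply measurable_fst hU.measurableSet]
    exact hz _ (hU.preimage continuous_fst) hzU
  · rw [Measure.map_apply measurable_snd hU.measurableSet]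
    exact hz _ (hU.preimage continuous_snd) hzU

theorem prod_measureSupport_subset {X Y : Type*} [TopologicalSpace X] [MeasurableSpace X]
    [TopologicalSpace Y] [MeasurableSpace Y]
    (μ : Measure X) (ν : Measure Y) [SFinite ν] :
    measureSupport μ ×ˢ measureSupport ν ⊆ measureSupport (μ.prod ν) := by
  rintro ⟨x, y⟩ ⟨hx, hy⟩ U hU hxy hU0
  obtain ⟨V, W, hV, hW, hxV, hyW, hVW⟩ := isOpen_prod_iff.1 hU x y hxy
  have h0 := measure_mono_null hVW hU0
  rw [Measure.prod_prod] at h0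
  exact (mul_ne_zero (hx V hV hxV) (hy W hW hyW)) h0

theorem measureSupport_mono_of_absolutelyContinuous {X : Type*} [TopologicalSpace X]
    [MeasurableSpace X] {μ ν : Measure X} (h : μ ≪ ν) :
    measureSupport μ ⊆ measureSupport ν :=
  fun _ hx U hU hxU h0 => hx U hU hxU (h h0)

/-- if the set of `𝓕`-transports between `μ` and `ν` is nonempty then for any
`δ > 0` there is a `δ`-approximating `𝓕`-transport between `μ` and `ν` whose topological
support is all of `supp μ × supp ν`. -/
theorem stmt_8 {Ω : Type*} [TopologicalSpace Ω] [PolishSpace Ω]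
    [MeasurableSpace Ω] [BorelSpace Ω]
    (p : Ω → ℝ) (hpm : Measurable p) (hp0 : ∀ ω, 0 ≤ p ω)
    (G : Set (Ω → ℝ)) (hGmeas : ∀ g ∈ G, Measurable g)
    (hGnorm : ∀ g ∈ G, BddAbove (Set.range fun ω => |g ω| / (p ω + 1)))
    (μ ν : Measure Ω) [IsProbabilityMeasure μ] [IsProbabilityMeasure ν]
    (hpμ : Integrable p μ) (hpν : Integrable p ν)
    (δ : ℝ) (hδ : 0 < δ)
    (hex : ∃ π₀ : Measure (Ω × Ω), IsProbabilityMeasure π₀ ∧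
      π₀.map Prod.fst = μ ∧ π₀.map Prod.snd = ν ∧
      ∀ g ∈ G, ∀ h : Ω → ℝ, Measurable h → (∀ ω, 0 ≤ h ω) →
        (∃ M : ℝ, ∀ ω, h ω ≤ M) →
        ∫ ω, h ω * g ω ∂μ ≤ ∫ x : Ω × Ω, h x.1 * g x.2 ∂π₀) :
    ∃ π : Measure (Ω × Ω), IsProbabilityMeasure π ∧
      π.map Prod.fst = μ ∧ π.map Prod.snd = ν ∧
      (∀ g ∈ G, ∀ h : Ω → ℝ, Measurable h → (∀ ω, 0 ≤ h ω) →
        (∃ M : ℝ, ∀ ω, h ω ≤ M) →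
        (∫ ω, h ω * g ω ∂μ) - (∫ x : Ω × Ω, h x.1 * g x.2 ∂π)
          ≤ δ * (⨆ ω : Ω, h ω) * pNorm p g) ∧
      measureSupport π = (measureSupport μ) ×ˢ (measureSupport ν) := by
  obtain ⟨π₀, hπ₀, hfst, hsnd, hle⟩ := hex
  set C : ℝ := (∫ ω, p ω ∂μ + 1) + (∫ ω, p ω ∂ν + 1) with hC_def
  have hC : 0 < C := by
    have h1 : 0 ≤ ∫ ω, p ω ∂μ := integral_nonneg hp0
    have h2 : 0 ≤ ∫ ω, p ω ∂ν := integral_nonneg hp0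
    linarith
  obtain ⟨a, b, hab, hb, hbC⟩ : ∃ a b : NNReal, a + b = 1 ∧ b ≠ 0 ∧ (b : ℝ) * C ≤ δ := by
    have ht : 0 < min 1 (δ / C) := lt_min one_pos (div_pos hδ hC)
    refine ⟨⟨1 - min 1 (δ / C), sub_nonneg.2 (min_le_left _ _)⟩, ⟨min 1 (δ / C), ht.le⟩,
      NNReal.eq (sub_add_cancel _ _), fun h => ht.ne' (congrArg NNReal.toReal h), ?_⟩
    exact (le_div_iff₀ hC).1 (min_le_right _ _)
  have habR : (a : ℝ) + b = 1 := by exact_mod_cast hab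
  have hsmul (m : Measure Ω) : a • m + b • m = m := by rw [← add_smul, hab, one_smul]
  have hfst' : (μ.prod ν).map Prod.fst = μ := by simp
  have hsnd' : (μ.prod ν).map Prod.snd = ν := by simp
  have hπfst : (a • π₀ + b • μ.prod ν).map Prod.fst = μ := by
    rw [Measure.map_add _ _ measurable_fst, Measure.map_smul,
      Measure.map_smul, hfst, hfst', hsmul]
  have hπsnd : (a • π₀ + b • μ.prod ν).map Prod.snd = ν := by
    rw [Measure.map_add _ _ measurable_snd, Measure.map_smul,
      Measure.map_smul, hsnd, hsnd', hsmul]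
  refine ⟨a • π₀ + b • μ.prod ν, ?_, hπfst, hπsnd, ?_, ?_⟩
  · refine ⟨?_⟩
    rw [← Set.preimage_univ (f := Prod.fst), ← Measure.map_apply measurable_fst .univ, hπfst,
      measure_univ]
  · rintro g hg h hh hh0 ⟨M, hM⟩
    set S := ⨆ ω, h ω
    set N := pNorm p g
    have hhS (ω : Ω) : |h ω| ≤ S := by
      rw [abs_of_nonneg (hh0 ω)]
      exact le_ciSup ⟨M, Set.forall_mem_range.2 hM⟩ ω
    have hSN : 0 ≤ S * N := mul_nonneg (Real.iSup_nonneg hh0) (pNorm_nonneg hp0 g)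
    have hint (ρ : Measure (Ω × Ω)) [IsProbabilityMeasure ρ] (hρ : ρ.map Prod.snd = ν) :
        Integrable (fun x : Ω × Ω => h x.1 * g x.2) ρ :=
      integrable_mul_comp_of_bddAbove (f := fun x : Ω × Ω => h x.1) measurable_snd hp0
        (hρ ▸ hpν) (hGmeas g hg) (hGnorm g hg) (hh.comp measurable_fst) fun x => hhS x.1
    have hμ_le := abs_integral_mul_comp_le (ρ := μ) measurable_id hp0
      (by rwa [Measure.map_id]) (hGnorm g hg) hhS
    have hprod_le := abs_integral_mul_comp_le (ρ := μ.prod ν) (f := fun x => h x.1)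
      measurable_snd hp0 (by rwa [hsnd']) (hGnorm g hg) fun x => hhS x.1
    rw [Measure.map_id] at hμ_le
    rw [hsnd'] at hprod_le
    rw [integral_add_measure ((hint π₀ hsnd).smul_measure_nnreal)
      ((hint (μ.prod ν) hsnd').smul_measure_nnreal), integral_smul_nnreal_measure,
      integral_smul_nnreal_measure, NNReal.smul_def, NNReal.smul_def, smul_eq_mul, smul_eq_mul]
    have hle₀ := hle g hg h hh hh0 ⟨M, hM⟩
    set I := ∫ ω, h ω * g ω ∂μ
    set J := ∫ x : Ω × Ω, h x.1 * g x.2 ∂π₀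
    set K := ∫ x : Ω × Ω, h x.1 * g x.2 ∂μ.prod ν
    have hIK : I - K ≤ S * N * C := by
      have hI : I ≤ S * N * (∫ ω, p ω ∂μ + 1) := (le_abs_self _).trans hμ_le
      have hK : -K ≤ S * N * (∫ ω, p ω ∂ν + 1) := (neg_le_abs _).trans hprod_le
      rw [hC_def, mul_add]
      linarith
    calc I - (a * J + b * K) = a * (I - J) + b * (I - K) := by
          linear_combination (-I) * habR
      _ ≤ 0 + b * (S * N * C) := by
          gcongr
          exact mul_nonpos_of_nonneg_of_nonpos a.2 (sub_nonpos.2 hle₀)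
      _ = b * C * (S * N) := by ring
      _ ≤ δ * (S * N) := by gcongr
      _ = δ * S * N := by ring
  · apply Set.Subset.antisymm
    · have hsub := measureSupport_subset_prod_map (a • π₀ + b • μ.prod ν)
      rwa [hπfst, hπsnd] at hsub
    · refine (prod_measureSupport_subset μ ν).trans
        (measureSupport_mono_of_absolutelyContinuous fun s hs => ?_)
      have hs' : a • π₀ s + b • μ.prod ν s = 0 := hs
      exact (smul_eq_zero.1 (add_eq_zero.1 hs').2).resolve_left hb
end
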